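/- arXiv:0812.3385 — 2 statements merged into one kernel-verified Lean document; each statement's English description precedes it below -/
import Mathlib

section
/- Let α, β, γ, B, C be positive real numbers. Let (x_n)_{n≥-1} be any sequence with x_{-1}, x_0 ∈ (0,∞) satisfying x_{n+1} = (α + β·x_n + γ·x_{n-1})/(B·x_n + C·x_{n-1}) for all n ≥ 0. Then either x_n converges to the unique positive equilibrium x̄ (the unique positive root of (B+C)x² − (β+γ)x − α = 0), or there exists a prime period-two solution (φ, ψ) such that the subsequence of even-indexed terms converges to one of φ, ψ and the subsequence of odd-indexed terms converges to the other. -/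
open Filter Topology Set

/-- Numerator of the Lyapunov function for
`x (n + 2) = (α + β * x (n + 1) + γ * x n) / (B * x (n + 1) + C * x n)`. -/
def lyapunovNum (α β γ B C u v : ℝ) : ℝ :=
  -B * (2 * C - B) * C ^ 2 * u ^ 2 * v ^ 2 + 2 * β * (2 * C - B) * C ^ 2 * u * v * (u + v)
    + (2 * C - B) * C * (2 * β ^ 2 - (β * γ + α * B)) * (u ^ 2 + v ^ 2)
    + 2 * β * C * (2 * β ^ 2 + 2 * α * C - β * γ - α * B) * (u + v)
    + 2 * α * β * C * (2 * β - γ)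
    - (β * γ + α * B) * (2 * β ^ 2 + 2 * α * C - β * γ - α * B)

/-- The Lyapunov function is
`lyapunovNum u v / (lyapunovDen u * lyapunovDen v)`. -/
def lyapunovDen (α β γ B C v : ℝ) : ℝ :=
  -B * C * v ^ 2 + 2 * β * C * v - (β * γ + α * B)

theorem lyapunov_identity (α β γ B C u v w : ℝ)
    (h : w * (B * u + C * v) = α + β * u + γ * v) :
    lyapunovNum α β γ B C w u * lyapunovDen α β γ B C v
      - lyapunovNum α β γ B C u v * lyapunovDen α β γ B C w =
    -(2 * β ^ 2 * C ^ 2 * (2 * β - γ + (2 * C - B) * u) * (B * u + γ) * (w - v) ^ 2) := by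
  unfold lyapunovNum lyapunovDen
  linear_combination (4 * β ^ 2 * C ^ 2 * (2 * β - γ + (2 * C - B) * u) * (w - v)) * h

theorem equilibrium_unique {α β γ B C s t : ℝ} (hα : 0 < α) (hB : 0 < B) (hC : 0 < C)
    (hs : 0 < s) (ht : 0 < t)
    (hs_eq : s * (B * s + C * s) = α + β * s + γ * s)
    (ht_eq : (B + C) * t ^ 2 - (β + γ) * t - α = 0) : s = t := by
  have h : (s - t) * ((B + C) * s * t + α) = 0 := by
    linear_combination t * hs_eq - s * ht_eq
  rcases mul_eq_zero.1 h with h | h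
  · linarith
  · have : 0 < (B + C) * s * t + α := by positivity
    linarith

theorem exists_bounds {α β γ B C : ℝ} {x : ℕ → ℝ}
    (hα : 0 < α) (hβ : 0 < β) (hγ : 0 < γ) (hB : 0 < B) (hC : 0 < C) (hpos : ∀ n, 0 < x n)
    (hrec : ∀ n, x (n + 2) * (B * x (n + 1) + C * x n) = α + β * x (n + 1) + γ * x n) :
    ∃ a b, 0 < a ∧ ∀ n, x n ∈ Icc a b := by
  obtain ⟨a, ha, hax0, hax1, haB, haC⟩ :
      ∃ a, 0 < a ∧ a ≤ x 0 ∧ a ≤ x 1 ∧ B * a ≤ β ∧ C * a ≤ γ := by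
    refine ⟨min (min (x 0) (x 1)) (min (β / B) (γ / C)), ?_, ?_, ?_, ?_, ?_⟩
    · have := hpos 0
      have := hpos 1
      positivity
    · simp
    · simp
    · rw [mul_comm, ← le_div_iff₀ hB]
      simp
    · rw [mul_comm, ← le_div_iff₀ hC]
      simp
  have hlow : ∀ n, a ≤ x n
    | 0 => hax0
    | 1 => hax1
    | n + 2 => by
      have hu := hpos (n + 1)
      have hv := hpos n
      refine le_of_mul_le_mul_right ?_ (show 0 < B * x (n + 1) + C * x n by positivity)
      rw [hrec]
      nlinarith
  obtain ⟨b, hbx0, hbx1, hbB, hbC⟩ : ∃ b, x 0 ≤ b ∧ x 1 ≤ b ∧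
      β + α / (2 * a) ≤ B * b ∧ γ + α / (2 * a) ≤ C * b := by
    refine ⟨max (max (x 0) (x 1)) (max ((β + α / (2 * a)) / B) ((γ + α / (2 * a)) / C)),
      ?_, ?_, ?_, ?_⟩
    · simp
    · simp
    · rw [mul_comm B, ← div_le_iff₀ hB]
      simp
    · rw [mul_comm C, ← div_le_iff₀ hC]
      simp
  have hup : ∀ n, x n ≤ b
    | 0 => hbx0
    | 1 => hbx1
    | n + 2 => by
      have hu := hpos (n + 1)
      have hv := hpos n
      refine le_of_mul_le_mul_right ?_ (show 0 < B * x (n + 1) + C * x n by positivity)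
      rw [hrec]
      have h1 : α / (2 * a) * (2 * a) = α := by field_simp
      have h2 : 0 < α / (2 * a) := by positivity
      nlinarith [hlow n, hlow (n + 1), mul_le_mul_of_nonneg_right hbB hu.le,
        mul_le_mul_of_nonneg_right hbC hv.le, mul_le_mul_of_nonneg_left (hlow n) h2.le,
        mul_le_mul_of_nonneg_left (hlow (n + 1)) h2.le]
  exact ⟨a, b, ha, fun n => ⟨hlow n, hup n⟩⟩

/-- Every cluster point of a bounded sequence is the limit of `x (n + 2)` along an ultrafilter
along which `x n` and `x (n + 1)` converge as well. -/
theorem MapClusterPt.exists_ultrafilter_shift {x : ℕ → ℝ} {a b s : ℝ}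
    (hx : ∀ n, x n ∈ Icc a b) (hs : MapClusterPt s atTop x) :
    ∃ (U : Ultrafilter ℕ) (u v : ℝ), (U : Filter ℕ) ≤ atTop ∧
      Tendsto (fun n => x (n + 2)) U (𝓝 s) ∧ Tendsto (fun n => x (n + 1)) U (𝓝 u) ∧
      Tendsto x U (𝓝 v) ∧ MapClusterPt u atTop x ∧ MapClusterPt v atTop x := by
  obtain ⟨W, hW, hWs⟩ := mapClusterPt_iff_ultrafilter.1 hs
  set U : Ultrafilter ℕ := W.map (fun n => n - 2) with hU
  have hUtop : (U : Filter ℕ) ≤ atTop := (tendsto_sub_atTop_nat 2).mono_left hW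
  have hlim (f : ℕ → ℝ) (hf : ∀ n, f n ∈ Icc a b) : ∃ u, Tendsto f U (𝓝 u) := by
    obtain ⟨u, -, hu⟩ := (isCompact_Icc (a := a) (b := b)).ultrafilter_le_nhds (U.map f)
      (tendsto_principal.2 (Filter.Eventually.of_forall hf))
    exact ⟨u, hu⟩
  obtain ⟨u, hu⟩ := hlim (fun n => x (n + 1)) fun n => hx _
  obtain ⟨v, hv⟩ := hlim x hx
  refine ⟨U, u, v, hUtop, ?_, hu, hv, ?_, ?_⟩
  · change Tendsto (fun n => x (n + 2)) (map (fun n => n - 2) (W : Filter ℕ)) (𝓝 s)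
    rw [tendsto_map'_iff]
    refine hWs.congr' ?_
    filter_upwards [hW (eventually_ge_atTop 2)] with n hn
    simp [Nat.sub_add_cancel hn]
  · refine mapClusterPt_iff_ultrafilter.2 ⟨U.map (fun n => n + 1), ?_, ?_⟩
    · exact (tendsto_add_atTop_nat 1).mono_left hUtop
    · rw [Ultrafilter.coe_map, tendsto_map'_iff]
      exact hu
  · exact mapClusterPt_iff_ultrafilter.2 ⟨U, hUtop, hv⟩

theorem exists_preimage_of_mapClusterPt {α β γ B C a b s : ℝ} {x : ℕ → ℝ}
    (hrec : ∀ n, x (n + 2) * (B * x (n + 1) + C * x n) = α + β * x (n + 1) + γ * x n)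
    (hx : ∀ n, x n ∈ Icc a b) (hs : MapClusterPt s atTop x) :
    ∃ u v, MapClusterPt u atTop x ∧ MapClusterPt v atTop x ∧
      s * (B * u + C * v) = α + β * u + γ * v := by
  obtain ⟨U, u, v, -, h2, h1, h0, hu, hv⟩ := hs.exists_ultrafilter_shift hx
  refine ⟨u, v, hu, hv, tendsto_nhds_unique
    (h2.mul ((h1.const_mul B).add (h0.const_mul C))) ?_⟩
  simp only [hrec]
  exact (tendsto_const_nhds.add (h1.const_mul β)).add (h0.const_mul γ)

theorem MapClusterPt.mem_of_eventually_mem {x : ℕ → ℝ} {s : ℝ} {K : Set ℝ} (hK : IsClosed K)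
    (hx : ∀ᶠ n in atTop, x n ∈ K) (hs : MapClusterPt s atTop x) : s ∈ K := by
  obtain ⟨U, hU, hUs⟩ := mapClusterPt_iff_ultrafilter.1 hs
  exact hK.mem_of_tendsto hUs (hU hx)

theorem exists_extremal_mapClusterPt {x : ℕ → ℝ} {a b : ℝ} (hx : ∀ n, x n ∈ Icc a b) :
    ∃ I S, MapClusterPt I atTop x ∧ MapClusterPt S atTop x ∧
      ∀ s, MapClusterPt s atTop x → s ∈ Icc I S := by
  have hsub : {s | MapClusterPt s atTop x} ⊆ Icc a b := fun s hs =>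
    MapClusterPt.mem_of_eventually_mem isClosed_Icc (Filter.Eventually.of_forall hx) hs
  have hcomp : IsCompact {s | MapClusterPt s atTop x} :=
    isCompact_Icc.of_isClosed_subset isClosed_setOfPred_clusterPt hsub
  have hne : {s | MapClusterPt s atTop x}.Nonempty := by
    obtain ⟨s, -, hs⟩ := (isCompact_Icc (a := a) (b := b)).exists_mapClusterPt
      (f := atTop) (u := x) (tendsto_principal.2 (Filter.Eventually.of_forall hx))
    exact ⟨s, hs⟩
  obtain ⟨I, hI, hI'⟩ := hcomp.exists_isLeast hne
  obtain ⟨S, hS, hS'⟩ := hcomp.exists_isGreatest hne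
  exact ⟨I, S, hI, hS, fun s hs => ⟨hI' hs, hS' hs⟩⟩

theorem eventually_lt_of_forall_mapClusterPt_lt {x : ℕ → ℝ} {a b c : ℝ} (hx : ∀ n, x n ∈ Icc a b)
    (hc : ∀ s, MapClusterPt s atTop x → s < c) : ∀ᶠ n in atTop, x n < c := by
  by_contra h
  obtain ⟨s, hs, hsx⟩ := (isCompact_Icc (a := c) (b := b)).exists_mapClusterPt_of_frequently
    (l := atTop) (f := x) ((not_eventually.1 h).mono fun n hn => ⟨not_lt.1 hn, (hx n).2⟩)
  exact absurd (hc s hsx) (not_lt.2 hs.1)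

theorem tendsto_equilibrium_of_mapClusterPt_eq {α β γ B C a b t I : ℝ} {x : ℕ → ℝ}
    (hα : 0 < α) (hB : 0 < B) (hC : 0 < C)
    (hrec : ∀ n, x (n + 2) * (B * x (n + 1) + C * x n) = α + β * x (n + 1) + γ * x n)
    (ha : 0 < a) (hx : ∀ n, x n ∈ Icc a b) (ht : 0 < t)
    (ht_eq : (B + C) * t ^ 2 - (β + γ) * t - α = 0)
    (hI : ∀ s, MapClusterPt s atTop x → s = I) : Tendsto x atTop (𝓝 t) := by
  refine isCompact_Icc.tendsto_nhds_of_unique_mapClusterPt (Filter.Eventually.of_forall hx) ?_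
  intro s hsab hs
  obtain ⟨u, v, hu, hv, huv⟩ := exists_preimage_of_mapClusterPt hrec hx hs
  have hsI := hI s hs
  have hus : u = s := (hI u hu).trans hsI.symm
  have hvs : v = s := (hI v hv).trans hsI.symm
  subst hus hvs
  exact equilibrium_unique hα hB hC (ha.trans_le hsab.1) ht huv ht_eq

theorem tendsto_equilibrium_of_tendsto_sub {α β γ B C a b t : ℝ} {x : ℕ → ℝ}
    (hα : 0 < α) (hβ : 0 < β) (hγ : 0 < γ) (hB : 0 < B) (hC : 0 < C)
    (hrec : ∀ n, x (n + 2) * (B * x (n + 1) + C * x n) = α + β * x (n + 1) + γ * x n)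
    (ha : 0 < a) (hx : ∀ n, x n ∈ Icc a b) (ht : 0 < t)
    (ht_eq : (B + C) * t ^ 2 - (β + γ) * t - α = 0) (haγ : γ ≤ C * a)
    (hsub : Tendsto (fun n => x (n + 2) - x n) atTop (𝓝 0)) : Tendsto x atTop (𝓝 t) := by
  refine isCompact_Icc.tendsto_nhds_of_unique_mapClusterPt (Filter.Eventually.of_forall hx) ?_
  intro s hsab hs
  obtain ⟨U, u, v, hU, h2, h1, h0, hu, -⟩ := hs.exists_ultrafilter_shift hx
  have huab : u ∈ Icc a b :=
    MapClusterPt.mem_of_eventually_mem isClosed_Icc (Filter.Eventually.of_forall hx) hu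
  have hsv : s = v := by
    have := tendsto_nhds_unique (h2.sub h0) (hsub.mono_left hU)
    linarith
  subst hsv
  have h3 : Tendsto (fun n => x (n + 3)) U (𝓝 u) := by
    have := ((hsub.comp (tendsto_add_atTop_nat 1)).mono_left hU).add h1
    simpa [Function.comp_def, add_assoc] using this
  have e1 : s * (B * u + C * s) = α + β * u + γ * s := by
    refine tendsto_nhds_unique (h2.mul ((h1.const_mul B).add (h0.const_mul C))) ?_
    simp only [hrec]
    exact (tendsto_const_nhds.add (h1.const_mul β)).add (h0.const_mul γ)
  have e2 : u * (B * s + C * u) = α + β * s + γ * u := by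
    refine tendsto_nhds_unique (h3.mul ((h2.const_mul B).add (h1.const_mul C))) ?_
    simp only [fun n => hrec (n + 1)]
    exact (tendsto_const_nhds.add (h2.const_mul β)).add (h1.const_mul γ)
  have hprod : (s - u) * (C * (s + u) + β - γ) = 0 := by linear_combination e1 - e2
  have hfac : 0 < C * (s + u) + β - γ := by nlinarith [hsab.1, huab.1]
  have hsu : u = s := by
    rcases mul_eq_zero.1 hprod with h | h <;> linarith
  subst hsu
  exact equilibrium_unique hα hB hC (ha.trans_le hsab.1) ht e1 ht_eq

theorem tendsto_sub_of_lyapunov {α β γ B C a b δ : ℝ} {x : ℕ → ℝ}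
    (hα : 0 < α) (hβ : 0 < β) (hγ : 0 < γ) (hB : 0 < B) (hC : 0 < C)
    (hrec : ∀ n, x (n + 2) * (B * x (n + 1) + C * x n) = α + β * x (n + 1) + γ * x n)
    (hx : ∀ n, x n ∈ Icc a b) (hγx : ∀ n, γ ≤ C * x n) (hδ : 0 < δ)
    (hβx : ∀ n, B * x n ≤ β - δ) (hD : 0 < β * C - B * γ) :
    Tendsto (fun n => x (n + 2) - x n) atTop (𝓝 0) := by
  have hpos (n) : 0 < x n := by
    have := hγx n
    by_contra h
    nlinarith
  set d : ℝ → ℝ := lyapunovDen α β γ B C with hd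
  set V : ℕ → ℝ := fun n => lyapunovNum α β γ B C (x (n + 1)) (x n) / (d (x (n + 1)) * d (x n))
    with hV
  have hdlow (n) : δ * γ ≤ d (x n) := by
    have h1 : (β - B * x (n + 2)) * (B * x (n + 1) + C * x n)
        = (β * C - B * γ) * x n - α * B := by linear_combination -B * hrec n
    have h2 : d (x n) = (β - B * x n) * (C * x n - γ) + ((β * C - B * γ) * x n - α * B) := by
      simp only [hd, lyapunovDen]
      ring
    have h3 : 0 ≤ (β - B * x n) * (C * x n - γ) :=
      mul_nonneg (by linarith [hβx n]) (by linarith [hγx n])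
    have h4 : δ * γ ≤ (β - B * x (n + 2)) * (B * x (n + 1) + C * x n) := by
      have := mul_pos hB (hpos (n + 1))
      exact mul_le_mul (by linarith [hβx (n + 2)]) (by linarith [hγx n]) hγ.le
        (by linarith [hβx (n + 2)])
    linarith
  have hdpos (n) : 0 < d (x n) := (mul_pos hδ hγ).trans_le (hdlow n)
  set K : ℝ := 2 * β * C * b with hK
  have hdup (n) : d (x n) ≤ K := by
    have h1 : β * C * x n ≤ β * C * b := mul_le_mul_of_nonneg_left (hx n).2 (by positivity)
    have h2 : 0 ≤ B * C * x n ^ 2 := by positivity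
    have h3 : 0 < β * γ + α * B := by positivity
    simp only [hd, lyapunovDen]
    linarith
  have hKpos : 0 < K := (hdpos 0).trans_le (hdup 0)
  have hdiff (n) : V n - V (n + 1) =
      2 * β ^ 2 * C ^ 2 * (2 * β - γ + (2 * C - B) * x (n + 1)) * (B * x (n + 1) + γ)
        * (x (n + 2) - x n) ^ 2 / (d (x n) * d (x (n + 1)) * d (x (n + 2))) := by
    have h0 := (hdpos n).ne'
    have h1 := (hdpos (n + 1)).ne'
    have h2 := (hdpos (n + 2)).ne'
    have := lyapunov_identity α β γ B C _ _ _ (hrec n)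
    simp only [hV, add_assoc, one_add_one_eq_two]
    rw [← hd] at this
    field_simp
    linear_combination -this
  have hm (n) : β ≤ 2 * β - γ + (2 * C - B) * x n := by
    have h1 := hγx n
    have h2 := hβx n
    rcases le_total B (2 * C) with h | h
    · have : 0 ≤ (2 * C - B) * (C * x n - γ) := mul_nonneg (by linarith) (by linarith)
      refine le_of_mul_le_mul_right ?_ hC
      nlinarith [mul_pos hC hβ, mul_pos hC hγ]
    · have : 0 ≤ (B - 2 * C) * (β - B * x n) := mul_nonneg (by linarith) (by linarith)
      refine le_of_mul_le_mul_right ?_ hB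
      nlinarith [mul_pos hC hβ, mul_pos hB hβ]
  set c : ℝ := 2 * β ^ 2 * C ^ 2 * β * γ / (K * K * K) with hc
  have hcpos : 0 < c := by positivity
  have hdec (n) : c * (x (n + 2) - x n) ^ 2 ≤ V n - V (n + 1) := by
    rw [hdiff, hc, div_mul_eq_mul_div]
    have h0 := hdpos n
    have h1 := hdpos (n + 1)
    have h2 := hdpos (n + 2)
    have h3 := hm (n + 1)
    have h4 := mul_pos hB (hpos (n + 1))
    have h5 : 0 < 2 * β - γ + (2 * C - B) * x (n + 1) := hβ.trans_le h3
    have h6 : γ ≤ B * x (n + 1) + γ := by linarith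
    have h7 := hdup n
    have h8 := hdup (n + 1)
    have h9 := hdup (n + 2)
    gcongr
  have hanti : Antitone V := antitone_nat_of_succ_le fun n => by
    have := hdec n
    have : 0 ≤ c * (x (n + 2) - x n) ^ 2 := by positivity
    linarith
  have hbdd : BddBelow (range V) := by
    obtain ⟨M, hM⟩ := ((isCompact_Icc (a := a) (b := b)).prod
      (isCompact_Icc (a := a) (b := b))).exists_bound_of_continuousOn
      (f := fun p : ℝ × ℝ => lyapunovNum α β γ B C p.1 p.2)
      (by unfold lyapunovNum; fun_prop)
    refine ⟨-(M / (δ * γ * (δ * γ))), ?_⟩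
    rintro _ ⟨n, rfl⟩
    have h1 := hM (x (n + 1), x n) ⟨hx _, hx _⟩
    refine (abs_le.1 ?_).1
    simp only [hV, abs_div, abs_mul, abs_of_pos (hdpos _)]
    have h2 : |lyapunovNum α β γ B C (x (n + 1)) (x n)| ≤ M := h1
    have h3 := hdlow n
    have h4 := hdlow (n + 1)
    have h5 := hdpos (n + 1)
    have h6 : 0 ≤ M := (abs_nonneg _).trans h2
    gcongr
  have hlim := tendsto_atTop_ciInf hanti hbdd
  have hVsub : Tendsto (fun n => (V n - V (n + 1)) / c) atTop (𝓝 0) := by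
    simpa using (hlim.sub (hlim.comp (tendsto_add_atTop_nat 1))).div_const c
  have hsq : Tendsto (fun n => (x (n + 2) - x n) ^ 2) atTop (𝓝 0) :=
    squeeze_zero (fun n => sq_nonneg _)
      (fun n => (le_div_iff₀ hcpos).2 (by linarith [hdec n])) hVsub
  rw [tendsto_zero_iff_abs_tendsto_zero]
  simpa [Function.comp_def, Real.sqrt_sq_eq_abs] using hsq.sqrt

/-- If the extreme values `I ≤ S` of the limit set are attained by the map, and the map is
decreasing in its second argument, then they coincide as soon as `β ≤ B * S`. -/
theorem extremal_le {α β γ B C I S u v u' v' : ℝ}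
    (hβ : 0 < β) (hγ : 0 < γ) (hB : 0 < B) (hI : 0 < I)
    (hu : u ∈ Icc I S) (hv : v ∈ Icc I S) (hu' : u' ∈ Icc I S) (hv' : v' ∈ Icc I S)
    (hS_eq : S * (B * u + C * v) = α + β * u + γ * v)
    (hI_eq : I * (B * u' + C * v') = α + β * u' + γ * v')
    (hγI : γ ≤ C * I) (hγS : γ ≤ C * S) (hβS : β ≤ B * S) : S ≤ I := by
  have hP : 0 ≤ α + β * I + γ * I - S * (B * I + C * I) := by
    nlinarith [mul_nonneg (sub_nonneg.2 hβS) (sub_nonneg.2 hu.1),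
      mul_nonneg (sub_nonneg.2 hγS) (sub_nonneg.2 hv.1)]
  rcases le_total (B * I) β with h | h
  · have hQ : α + β * I + γ * S - I * (B * I + C * S) ≤ 0 := by
      nlinarith [mul_nonneg (sub_nonneg.2 h) (sub_nonneg.2 hu'.1),
        mul_nonneg (sub_nonneg.2 hγI) (sub_nonneg.2 hv'.2)]
    have : 0 < γ + B * I := by positivity
    nlinarith
  · have hQ : α + β * S + γ * S - I * (B * S + C * S) ≤ 0 := by
      nlinarith [mul_nonneg (sub_nonneg.2 h) (sub_nonneg.2 hu'.2),
        mul_nonneg (sub_nonneg.2 hγI) (sub_nonneg.2 hv'.2)]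
    by_contra hlt
    have : 0 < (β + γ) * (S - I) := mul_pos (by positivity) (by linarith)
    linarith

theorem mixed_monotone {α β γ B C u v w u' v' w' : ℝ} (hα : 0 < α)
    (hB : 0 < B) (hC : 0 < C) (hu : 0 < u) (hv : 0 < v) (hv' : 0 < v')
    (hw : w * (B * u + C * v) = α + β * u + γ * v)
    (hw' : w' * (B * u' + C * v') = α + β * u' + γ * v')
    (hD : α * C ≤ (B * γ - β * C) * u') (huu : u ≤ u') (hvv : v' ≤ v) : w' ≤ w := by
  have hu' : 0 < u' := hu.trans_le huu
  have hDpos : 0 < B * γ - β * C := by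
    by_contra h
    have := mul_pos hα hC
    nlinarith
  have e : w = (α + β * u + γ * v) / (B * u + C * v) := by
    rw [← hw]
    field_simp
  have e' : w' = (α + β * u' + γ * v') / (B * u' + C * v') := by
    rw [← hw']
    field_simp
  rw [e, e']
  trans (α + β * u' + γ * v) / (B * u' + C * v)
  · rw [div_le_div_iff₀ (by positivity) (by positivity)]
    nlinarith [mul_nonneg (sub_nonneg.2 hD) (sub_nonneg.2 hvv)]
  · rw [div_le_div_iff₀ (by positivity) (by positivity)]
    have : 0 < α * B + (B * γ - β * C) * v := by positivity
    nlinarith [mul_nonneg this.le (sub_nonneg.2 huu)]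

/-- Camouzis–Ladas: under a mixed-monotone recursion the two parity subsequences are eventually
monotone, hence convergent when bounded. -/
theorem exists_tendsto_even_odd {x : ℕ → ℝ} {a b : ℝ} (hx : ∀ n, x n ∈ Icc a b)
    (hle : ∀ n, x (n + 1) ≤ x (n + 3) → x (n + 2) ≤ x n → x (n + 4) ≤ x (n + 2))
    (hge : ∀ n, x (n + 3) ≤ x (n + 1) → x n ≤ x (n + 2) → x (n + 2) ≤ x (n + 4)) :
    ∃ p q, Tendsto (fun n => x (2 * n)) atTop (𝓝 p) ∧
      Tendsto (fun n => x (2 * n + 1)) atTop (𝓝 q) := by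
  have hup (m : ℕ) (h : ∀ k, x (m + 2 * k) ≤ x (m + 2 * k + 2)) :
      ∃ p, Tendsto (fun k => x (m + 2 * k)) atTop (𝓝 p) :=
    ⟨_, tendsto_atTop_ciSup (monotone_nat_of_le_succ h)
      ⟨b, by rintro _ ⟨k, rfl⟩; exact (hx _).2⟩⟩
  have hdown (m : ℕ) (h : ∀ k, x (m + 2 * k + 2) ≤ x (m + 2 * k)) :
      ∃ p, Tendsto (fun k => x (m + 2 * k)) atTop (𝓝 p) :=
    ⟨_, tendsto_atTop_ciInf (antitone_nat_of_succ_le h)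
      ⟨a, by rintro _ ⟨k, rfl⟩; exact (hx _).1⟩⟩
  have key : ∃ m, (∃ p, Tendsto (fun k => x (m + 2 * k)) atTop (𝓝 p)) ∧
      ∃ q, Tendsto (fun k => x (m + 1 + 2 * k)) atTop (𝓝 q) := by
    by_cases h1 : ∃ n, x n ≤ x (n + 2) ∧ x (n + 3) ≤ x (n + 1)
    · obtain ⟨n, hn⟩ := h1
      have hall (k : ℕ) : x (n + 2 * k) ≤ x (n + 2 * k + 2) ∧
          x (n + 1 + 2 * k + 2) ≤ x (n + 1 + 2 * k) := by
        induction k with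
        | zero => simpa [add_assoc] using hn
        | succ k ih =>
          rw [show n + 1 + 2 * k = n + 2 * k + 1 by ring] at ih
          have h2 := hge _ ih.2 ih.1
          exact ⟨h2, by convert hle _ h2 ih.2 using 2 <;> ring⟩
      exact ⟨n, hup n fun k => (hall k).1, hdown (n + 1) fun k => (hall k).2⟩
    by_cases h2 : ∃ n, x (n + 2) ≤ x n ∧ x (n + 1) ≤ x (n + 3)
    · obtain ⟨n, hn⟩ := h2
      have hall (k : ℕ) : x (n + 2 * k + 2) ≤ x (n + 2 * k) ∧
          x (n + 1 + 2 * k) ≤ x (n + 1 + 2 * k + 2) := by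
        induction k with
        | zero => simpa [add_assoc] using hn
        | succ k ih =>
          rw [show n + 1 + 2 * k = n + 2 * k + 1 by ring] at ih
          have h2 := hle _ ih.2 ih.1
          exact ⟨h2, by convert hge _ h2 ih.2 using 2 <;> ring⟩
      exact ⟨n, hdown n fun k => (hall k).1, hup (n + 1) fun k => (hall k).2⟩
    push Not at h1 h2
    rcases le_total (x 0) (x 2) with h | h
    · have hall (n : ℕ) : x n ≤ x (n + 2) := by
        induction n with
        | zero => exact h
        | succ n ih => exact (h1 n ih).le
      exact ⟨0, hup 0 fun k => hall _, hup 1 fun k => hall _⟩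
    · have hall (n : ℕ) : x (n + 2) ≤ x n := by
        induction n with
        | zero => exact h
        | succ n ih => exact (h2 n ih).le
      exact ⟨0, hdown 0 fun k => hall _, hdown 1 fun k => hall _⟩
  obtain ⟨m, ⟨p, hp⟩, q, hq⟩ := key
  obtain ⟨j, rfl | rfl⟩ := Nat.even_or_odd' m
  · refine ⟨p, q, (tendsto_add_atTop_iff_nat j).1 (hp.congr fun k => ?_),
      (tendsto_add_atTop_iff_nat j).1 (hq.congr fun k => ?_)⟩ <;> congr 1 <;> ring
  · refine ⟨q, p, (tendsto_add_atTop_iff_nat (j + 1)).1 (hq.congr fun k => ?_),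
      (tendsto_add_atTop_iff_nat j).1 (hp.congr fun k => ?_)⟩ <;> congr 1 <;> ring

theorem tendsto_of_tendsto_even_odd {x : ℕ → ℝ} {p : ℝ}
    (h0 : Tendsto (fun n => x (2 * n)) atTop (𝓝 p))
    (h1 : Tendsto (fun n => x (2 * n + 1)) atTop (𝓝 p)) : Tendsto x atTop (𝓝 p) := by
  rw [Metric.tendsto_atTop] at *
  intro ε hε
  obtain ⟨N, hN⟩ := h0 ε hε
  obtain ⟨M, hM⟩ := h1 ε hε
  refine ⟨2 * N + 2 * M + 1, fun n hn => ?_⟩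
  obtain ⟨j, rfl | rfl⟩ := Nat.even_or_odd' n
  · exact hN j (by lia)
  · exact hM j (by lia)

theorem tendsto_equilibrium_of_le {α β γ B C t : ℝ} {x : ℕ → ℝ}
    (hα : 0 < α) (hβ : 0 < β) (hγ : 0 < γ) (hB : 0 < B) (hC : 0 < C) (hpos : ∀ n, 0 < x n)
    (hrec : ∀ n, x (n + 2) * (B * x (n + 1) + C * x n) = α + β * x (n + 1) + γ * x n)
    (ht : 0 < t) (ht_eq : (B + C) * t ^ 2 - (β + γ) * t - α = 0) (hD : B * γ ≤ β * C) :
    Tendsto x atTop (𝓝 t) := by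
  obtain ⟨a, b, ha, hx⟩ := exists_bounds hα hβ hγ hB hC hpos hrec
  have hγx (n) : γ < C * x (n + 2) := by
    have hu := hpos (n + 1)
    have hv := hpos n
    have h1 : (C * x (n + 2) - γ) * (B * x (n + 1) + C * x n)
        = α * C + (β * C - B * γ) * x (n + 1) := by linear_combination C * hrec n
    have h2 : 0 < (C * x (n + 2) - γ) * (B * x (n + 1) + C * x n) := by
      rw [h1]
      have := mul_nonneg (sub_nonneg.2 hD) hu.le
      positivity
    linarith [pos_of_mul_pos_left h2 (show 0 ≤ B * x (n + 1) + C * x n by positivity)]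
  obtain ⟨I, S, hI, hS, hIS⟩ := exists_extremal_mapClusterPt hx
  have hcluster (s) (hs : MapClusterPt s atTop x) : 0 < s ∧ γ ≤ C * s := by
    have h1 : s ∈ Ici (γ / C) := by
      refine MapClusterPt.mem_of_eventually_mem isClosed_Ici ?_ hs
      filter_upwards [eventually_ge_atTop 2] with n hn
      obtain ⟨k, rfl⟩ := Nat.exists_eq_add_of_le' hn
      exact (div_le_iff₀' hC).2 (hγx k).le
    exact ⟨(div_pos hγ hC).trans_le h1, (div_le_iff₀' hC).1 h1⟩
  obtain ⟨u, v, hu, hv, huv⟩ := exists_preimage_of_mapClusterPt hrec hx hS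
  obtain ⟨u', v', hu', hv', huv'⟩ := exists_preimage_of_mapClusterPt hrec hx hI
  rcases le_or_gt β (B * S) with hβS | hβS
  · have hSI := extremal_le hβ hγ hB (hcluster I hI).1 (hIS u hu) (hIS v hv) (hIS u' hu')
      (hIS v' hv') huv huv' (hcluster I hI).2 (hcluster S hS).2 hβS
    refine tendsto_equilibrium_of_mapClusterPt_eq (I := I) hα hB hC hrec ha hx ht ht_eq
      fun s hs => ?_
    exact le_antisymm ((hIS s hs).2.trans hSI) (hIS s hs).1
  · obtain ⟨c, hSc, hc⟩ := exists_between ((lt_div_iff₀' hB).2 hβS)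
    obtain ⟨N, hN⟩ := eventually_atTop.1
      (eventually_lt_of_forall_mapClusterPt_lt hx fun s hs => (hIS s hs).2.trans_lt hSc)
    have hBc : B * c < β := (lt_div_iff₀' hB).1 hc
    have hγy (n) : γ ≤ C * x (n + (N + 2)) := (hγx (n + N)).le
    have hβy (n) : B * x (n + (N + 2)) ≤ β - (β - B * c) := by
      have := mul_le_mul_of_nonneg_left (hN (n + (N + 2)) (by lia)).le hB.le
      linarith
    have hy (n) : x (n + (N + 2)) ∈ Icc (γ / C) b := ⟨(div_le_iff₀' hC).2 (hγy n), (hx _).2⟩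
    have hrecy (n) : x (n + 2 + (N + 2)) * (B * x (n + 1 + (N + 2)) + C * x (n + (N + 2)))
        = α + β * x (n + 1 + (N + 2)) + γ * x (n + (N + 2)) := by
      rw [add_right_comm n 2, add_right_comm n 1]
      exact hrec _
    have hDpos : 0 < β * C - B * γ := by
      have h1 := mul_le_mul_of_nonneg_left (hγy 0) hB.le
      have h2 := mul_le_mul_of_nonneg_left (hβy 0) hC.le
      nlinarith
    refine (tendsto_add_atTop_iff_nat (N + 2)).1 ?_
    refine tendsto_equilibrium_of_tendsto_sub hα hβ hγ hB hC hrecy (div_pos hγ hC) hy ht ht_eq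
      (mul_div_cancel₀ γ hC.ne').ge ?_
    exact tendsto_sub_of_lyapunov hα hβ hγ hB hC hrecy hy hγy (sub_pos.2 hBc) hβy hDpos

theorem exists_tendsto_even_odd_of_not_tendsto {α β γ B C t : ℝ} {x : ℕ → ℝ}
    (hα : 0 < α) (hβ : 0 < β) (hγ : 0 < γ) (hB : 0 < B) (hC : 0 < C) (hpos : ∀ n, 0 < x n)
    (hrec : ∀ n, x (n + 2) * (B * x (n + 1) + C * x n) = α + β * x (n + 1) + γ * x n)
    (ht : 0 < t) (ht_eq : (B + C) * t ^ 2 - (β + γ) * t - α = 0) (hD : β * C ≤ B * γ)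
    (hxt : ¬ Tendsto x atTop (𝓝 t)) :
    ∃ p q, 0 < p ∧ 0 < q ∧ Tendsto (fun n => x (2 * n)) atTop (𝓝 p) ∧
      Tendsto (fun n => x (2 * n + 1)) atTop (𝓝 q) := by
  obtain ⟨a, b, ha, hx⟩ := exists_bounds hα hβ hγ hB hC hpos hrec
  have hβx (n) : β < B * x (n + 2) := by
    have hu := hpos (n + 1)
    have hv := hpos n
    have h1 : (B * x (n + 2) - β) * (B * x (n + 1) + C * x n)
        = α * B + (B * γ - β * C) * x n := by linear_combination B * hrec n
    have h2 : 0 < (B * x (n + 2) - β) * (B * x (n + 1) + C * x n) := by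
      rw [h1]
      have := mul_nonneg (sub_nonneg.2 hD) hv.le
      positivity
    linarith [pos_of_mul_pos_left h2 (show 0 ≤ B * x (n + 1) + C * x n by positivity)]
  obtain ⟨I, S, hI, hS, hIS⟩ := exists_extremal_mapClusterPt hx
  have hcluster (s) (hs : MapClusterPt s atTop x) : 0 < s ∧ β ≤ B * s := by
    have h1 : s ∈ Ici (β / B) := by
      refine MapClusterPt.mem_of_eventually_mem isClosed_Ici ?_ hs
      filter_upwards [eventually_ge_atTop 2] with n hn
      obtain ⟨k, rfl⟩ := Nat.exists_eq_add_of_le' hn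
      exact (div_le_iff₀' hB).2 (hβx k).le
    exact ⟨(div_pos hβ hB).trans_le h1, (div_le_iff₀' hB).1 h1⟩
  obtain ⟨u, v, hu, hv, huv⟩ := exists_preimage_of_mapClusterPt hrec hx hS
  obtain ⟨u', v', hu', hv', huv'⟩ := exists_preimage_of_mapClusterPt hrec hx hI
  rcases le_or_gt γ (C * S) with hγS | hγS
  · have hSI := extremal_le (α := α) hγ hβ hC (hcluster I hI).1 (hIS v hv) (hIS u hu) (hIS v' hv')
      (hIS u' hu') (by linear_combination huv) (by linear_combination huv')
      (hcluster I hI).2 (hcluster S hS).2 hγS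
    refine absurd (tendsto_equilibrium_of_mapClusterPt_eq (I := I) hα hB hC hrec ha hx ht ht_eq
      fun s hs => ?_) hxt
    exact le_antisymm ((hIS s hs).2.trans hSI) (hIS s hs).1
  · obtain ⟨N, hN⟩ := eventually_atTop.1 (eventually_lt_of_forall_mapClusterPt_lt hx
      fun s hs => (hIS s hs).2.trans_lt ((lt_div_iff₀' hC).2 hγS))
    have hregion (n) (hn : N ≤ n) : α * C ≤ (B * γ - β * C) * x (n + 1) := by
      have hu := hpos (n + 1)
      have hv := hpos n
      have h1 : C * x (n + 2) < γ := (lt_div_iff₀' hC).1 (hN (n + 2) (by lia))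
      have h2 : (γ - C * x (n + 2)) * (B * x (n + 1) + C * x n)
          = (B * γ - β * C) * x (n + 1) - α * C := by linear_combination -C * hrec n
      have h3 : 0 < (γ - C * x (n + 2)) * (B * x (n + 1) + C * x n) :=
        mul_pos (by linarith) (by positivity)
      linarith
    have hle (n) (hn : N ≤ n) (h1 : x (n + 1) ≤ x (n + 3)) (h2 : x (n + 2) ≤ x n) :
        x (n + 4) ≤ x (n + 2) :=
      mixed_monotone hα hB hC (hpos _) (hpos _) (hpos _) (hrec n) (hrec (n + 2))
        (hregion (n + 2) (by lia)) h1 h2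
    have hge (n) (hn : N ≤ n) (h1 : x (n + 3) ≤ x (n + 1)) (h2 : x n ≤ x (n + 2)) :
        x (n + 2) ≤ x (n + 4) :=
      mixed_monotone hα hB hC (hpos _) (hpos _) (hpos _) (hrec (n + 2)) (hrec n)
        (hregion n hn) h1 h2
    obtain ⟨p, q, hp, hq⟩ := exists_tendsto_even_odd (x := fun n => x (2 * N + n))
      (fun n => hx _) (fun n => hle (2 * N + n) (by lia)) (fun n => hge (2 * N + n) (by lia))
    refine ⟨p, q, ha.trans_le (ge_of_tendsto' hp fun n => (hx _).1),
      ha.trans_le (ge_of_tendsto' hq fun n => (hx _).1),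
      (tendsto_add_atTop_iff_nat N).1 (hp.congr fun k => ?_),
      (tendsto_add_atTop_iff_nat N).1 (hq.congr fun k => ?_)⟩ <;> congr 1 <;> ring

/-- Theorem 2 (Eq. (3-2) original form): every solution with positive initial
conditions converges to the unique positive equilibrium or to a prime
period-two solution. Here `x 0` plays the role of `x_{-1}` and `x 1` of `x_0`. -/
theorem stmt_1 (α β γ B C : ℝ)
    (hα : 0 < α) (hβ : 0 < β) (hγ : 0 < γ) (hB : 0 < B) (hC : 0 < C)
    (x : ℕ → ℝ) (hx0 : 0 < x 0) (hx1 : 0 < x 1)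
    (hrec : ∀ n : ℕ, x (n + 2) =
      (α + β * x (n + 1) + γ * x n) / (B * x (n + 1) + C * x n))
    (xbar : ℝ) (hxbar_pos : 0 < xbar)
    (hxbar_eq : (B + C) * xbar ^ 2 - (β + γ) * xbar - α = 0) :
    Tendsto x atTop (nhds xbar) ∨
      ∃ φ ψ : ℝ, φ ≠ ψ ∧ 0 < φ ∧ 0 < ψ ∧
        φ = (α + β * ψ + γ * φ) / (B * ψ + C * φ) ∧
        ψ = (α + β * φ + γ * ψ) / (B * φ + C * ψ) ∧
        ((Tendsto (fun n => x (2 * n)) atTop (nhds φ) ∧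
          Tendsto (fun n => x (2 * n + 1)) atTop (nhds ψ)) ∨
         (Tendsto (fun n => x (2 * n)) atTop (nhds ψ) ∧
          Tendsto (fun n => x (2 * n + 1)) atTop (nhds φ))) := by
  have hpos : ∀ n, 0 < x n := by
    intro n
    induction n using Nat.strong_induction_on with
    | _ n ih =>
      match n with
      | 0 => exact hx0
      | 1 => exact hx1
      | n + 2 =>
        have hu := ih (n + 1) (by lia)
        have hv := ih n (by lia)
        rw [hrec]
        positivity
  have hden (n : ℕ) : 0 < B * x (n + 1) + C * x n := by
    have hu := hpos (n + 1)
    have hv := hpos n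
    positivity
  have hmul (n : ℕ) : x (n + 2) * (B * x (n + 1) + C * x n) = α + β * x (n + 1) + γ * x n := by
    rw [hrec, div_mul_cancel₀ _ (hden n).ne']
  rcases le_total (B * γ) (β * C) with hD | hD
  · exact Or.inl (tendsto_equilibrium_of_le hα hβ hγ hB hC hpos hmul hxbar_pos hxbar_eq hD)
  by_cases hx : Tendsto x atTop (𝓝 xbar)
  · exact Or.inl hx
  obtain ⟨p, q, hp_pos, hq_pos, hp, hq⟩ :=
    exists_tendsto_even_odd_of_not_tendsto hα hβ hγ hB hC hpos hmul hxbar_pos hxbar_eq hD hx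
  have hp' : Tendsto (fun n => x (2 * n + 2)) atTop (𝓝 p) := hp.comp (tendsto_add_atTop_nat 1)
  have hq' : Tendsto (fun n => x (2 * n + 3)) atTop (𝓝 q) := hq.comp (tendsto_add_atTop_nat 1)
  have hp_eq : p * (B * q + C * p) = α + β * q + γ * p := by
    refine tendsto_nhds_unique (hp'.mul ((hq.const_mul B).add (hp.const_mul C))) ?_
    simp only [hmul]
    exact (tendsto_const_nhds.add (hq.const_mul β)).add (hp.const_mul γ)
  have hq_eq : q * (B * p + C * q) = α + β * p + γ * q := by
    refine tendsto_nhds_unique (hq'.mul ((hp'.const_mul B).add (hq.const_mul C))) ?_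
    simp only [fun n => hmul (2 * n + 1)]
    exact (tendsto_const_nhds.add (hp'.const_mul β)).add (hq.const_mul γ)
  refine Or.inr ⟨p, q, ?_, hp_pos, hq_pos, ?_, ?_, Or.inl ⟨hp, hq⟩⟩
  · rintro rfl
    refine hx ?_
    rw [← equilibrium_unique hα hB hC hp_pos hxbar_pos hp_eq hxbar_eq]
    exact tendsto_of_tendsto_even_odd hp hq
  · rw [← hp_eq]
    field_simp
  · rw [← hq_eq]
    field_simp
end

section
/- Let α, β, γ, A, B, C be positive real numbers, and define p = (A·B + (B+C)β)/(A·C + (B+C)γ), q = B/C, r = C(B+C)(B·α + C·α − A·β − A·γ)/((γ(B+C) + A·C)²), and L = A·C/(A·C + (B+C)γ). Let (y_n)_{n≥-1} be any sequence with y_{-1}, y_0 ∈ [L,∞) satisfying y_{n+1} = (r + p·y_n + y_{n-1})/(q·y_n + y_{n-1}) for all n ≥ 0. Then either y_n converges to the equilibrium ȳ = (p+1+√((p+1)² + 4r(q+1)))/(2(q+1)), or there exists a pair (φ, ψ) of distinct reals in [L,∞) with φ = (r + p·ψ + φ)/(q·ψ + φ) and ψ = (r + p·φ + ψ)/(q·φ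 + ψ) such that the even-indexed terms converge to one of φ, ψ and the odd-indexed terms converge to the other. -/
open Filter Topology Set

theorem energy_lower {g h q x y x₁ x₂ : ℝ} (hg : 0 < g) (hgh : g ≤ h) (hh : h < 1)
    (hq : 0 < q) (hq1 : q ≤ 1) (hx : 1 - h < x) (hy : 1 - h < y)
    (h₁ : (x₁ - 1) * (q * x + y) = g * (x - 1) - h * (y - 1))
    (h₂ : (x₂ - 1) * (q * x₁ + x) = g * (x₁ - 1) - h * (x - 1))
    (hy1 : y < 1) (hx1 : x₁ < 1) (hx1c : 1 - h < x₁) :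
    (x + g) * (x₁ - y) * ((1 - h) * (y - 1) - q * x * (x₁ - 1)) * x₂ +
      (x₁ + g) * (x₂ - x) * ((1 - h) * (x - 1) - q * x₁ * (x₂ - 1)) * y < 0 := by
  have hx0 : 0 < x := by linarith
  have hy0 : 0 < y := by linarith
  have hx10 : 0 < x₁ := by linarith
  have hD : 0 < q * x + y := by positivity
  have hD1 : 0 < q * x₁ + x := by positivity
  have hqx : 0 < q * x := by positivity
  have hxy : x < y := by
    have : (x₁ - 1) * (q * x + y) < 0 := mul_neg_of_neg_of_pos (by linarith) hD
    nlinarith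
  have hxx1 : x < x₁ := by
    by_contra! hc
    have e1 : (1 - x) * (q * x + y) ≤ (1 - x₁) * (q * x + y) := by gcongr
    nlinarith [mul_pos hqx (show 0 < 1 - x by linarith),
      mul_nonneg (show 0 ≤ h - g by linarith) (show 0 ≤ 1 - x by linarith),
      mul_pos hx0 (show 0 < 1 - y by linarith),
      mul_nonneg (show 0 ≤ 1 - h by linarith) (show 0 ≤ y - x by linarith)]
  have hx2 : 1 < x₂ := by
    by_contra! hc
    have : (x₂ - 1) * (q * x₁ + x) ≤ 0 := mul_nonpos_of_nonpos_of_nonneg (by linarith) hD1.le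
    nlinarith
  have hS' : (1 - h) * (x - 1) - q * x₁ * (x₂ - 1) < -(q * x₁ * (x₂ - 1)) := by
    nlinarith
  have hqx2 : 0 < q * x₁ * (x₂ - 1) := mul_pos (by positivity) (by linarith)
  have hc : 0 < (x₁ + g) * (x₂ - x) * y := by
    apply mul_pos (mul_pos (by linarith) (by linarith)) hy0
  have hx2x : 0 < x₂ - x := by linarith
  have hx1' : 0 < 1 - x₁ := by linarith
  have hy1' : 0 < 1 - y := by linarith
  have hh' : 0 < 1 - h := by linarith
  rcases le_or_gt ((x₁ - y) * ((1 - h) * (y - 1) - q * x * (x₁ - 1))) 0 with hle | hgt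
  · have e1 : (x + g) * x₂ * ((x₁ - y) * ((1 - h) * (y - 1) - q * x * (x₁ - 1))) ≤ 0 :=
      mul_nonpos_of_nonneg_of_nonpos (by positivity) hle
    have e2 : (x₁ + g) * (x₂ - x) * y * ((1 - h) * (x - 1) - q * x₁ * (x₂ - 1)) < 0 :=
      mul_neg_of_pos_of_neg hc (by linarith)
    linarith
  · rcases pos_and_pos_or_neg_and_neg_of_mul_pos hgt with ⟨ha, hb⟩ | ⟨ha, hb⟩
    · have key : 1 - x₁ ≤ x₂ - 1 := by
        by_contra! hc
        have e1 : (x₂ - 1) * (q * x₁ + x) ≤ (1 - x₁) * (q * x₁ + x) := by gcongr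
        have e2 : q * (1 - x₁) * (y - x) ≤ 1 * (1 - x₁) * (y - x) := by
          gcongr
        have e3 : q * (1 - x₁) * (x₁ - y) ≤ 1 * h * (x₁ - y) := by
          gcongr; linarith
        have e4 : (x₂ - 1) * (q * x₁ + x) < (1 - x₁) * (q * x₁ + x) := by gcongr
        nlinarith [mul_nonneg (show 0 ≤ h - g by linarith) (show 0 ≤ 1 - x by linarith),
          mul_nonneg (show 0 ≤ h - g by linarith) (show 0 ≤ 1 - x₁ by linarith)]
      have e1 : x * (x₁ - y) * x₂ ≤ x₁ * (x₂ - x) * y := by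
        nlinarith [mul_nonneg (mul_nonneg hx10.le (show 0 ≤ x₂ by linarith))
            (show 0 ≤ y - x by linarith),
          mul_nonneg (mul_nonneg hx0.le hy0.le) (show 0 ≤ x₂ - x₁ by linarith)]
      have e2 : (x + g) * (x₁ - y) * ((1 - h) * (y - 1) - q * x * (x₁ - 1)) * x₂ ≤
          (x + g) * (x₁ - y) * (q * x * (1 - x₁)) * x₂ := by
        gcongr
        nlinarith
      have e3 : (x + g) * (x * (x₁ - y) * x₂) * (q * (1 - x₁)) ≤
          (x₁ + g) * (x₁ * (x₂ - x) * y) * (q * (x₂ - 1)) := by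
        gcongr
      have e4 := mul_lt_mul_of_pos_left hS' hc
      linarith
    · have hyx1 : 0 < y - x₁ := by linarith
      have hqx1 : 0 < q * x * (1 - x₁) := mul_pos hqx hx1'
      have e1 : (y - x₁) * x₂ ≤ (x₂ - x) * y := by
        nlinarith [mul_nonneg hy0.le (show 0 ≤ x₁ - x by linarith),
          mul_nonneg hx10.le (show 0 ≤ x₂ - y by linarith)]
      have e2 : (x + g) * (y - x₁) * (-((1 - h) * (y - 1) - q * x * (x₁ - 1))) * x₂ ≤
          (x + g) * (y - x₁) * ((1 - h) * (1 - y)) * x₂ := by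
        gcongr; linarith
      have e3 : (x + g) * ((y - x₁) * x₂) * ((1 - h) * (1 - y)) ≤
          (x₁ + g) * ((x₂ - x) * y) * ((1 - h) * (1 - x)) := by
        gcongr
      have e4 : 0 < (x₁ + g) * (x₂ - x) * y * (q * x₁ * (x₂ - 1)) := mul_pos hc hqx2
      linarith

theorem upper_poly {a b g h : ℝ} (ha : 0 ≤ a) (hab : a ≤ b) (hg : 0 ≤ g) (hgh : g ≤ h)
    (hh : h ≤ 1) :
    g * a * (1 + a + g) * (1 + b) * (1 + a) + (b - a) * ((2 + g) * a * (h + g * a) +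
      (1 + a) * (g + g ^ 2 - h * b - a - a * b)) ≤
    ((1 + a) ^ 3 + g * (1 + a) * (1 + b)) * (h * b + a + a * b) := by
  obtain ⟨e, rfl⟩ : ∃ e, b = a + e := ⟨b - a, by ring⟩
  obtain ⟨k, rfl⟩ : ∃ k, h = g + k := ⟨h - g, by ring⟩
  obtain ⟨l, hl⟩ : ∃ l, l = 1 - g - k := ⟨_, rfl⟩
  have he : 0 ≤ e := by linarith
  have hk : 0 ≤ k := by linarith
  have hl0 : 0 ≤ l := by linarith
  rw [← sub_nonneg]
  ring_nf
  positivity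

theorem upper_quadratic {a b g h X : ℝ} (ha : 0 ≤ a) (hab : a ≤ b) (hbX : b ≤ X) (hg : 0 ≤ g)
    (hgh : g ≤ h) (hh : h ≤ 1) (hX : h * b + a + a * b ≤ g * X) :
    (1 + X + g) * (b - a) * ((1 + X) * a * (h + g * a) +
      (1 + a) * (g * X - h * b - a - a * b)) ≤
    (1 + a + g) * X * (1 + b) * (1 + a) * (h * X - g * a) := by
  have hX0 : 0 ≤ X := by linarith
  have hb : 0 ≤ b := by linarith
  have hh0 : 0 ≤ h := by linarith
  have hba : 0 ≤ b - a := by linarith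
  have hgX : g * X ≤ h * X := by gcongr
  have h₁ : (b - a) * (a * (h + g * a) + g * (1 + a)) ≤
    (b - a) * (a * (h + h * a) + h * (1 + a)) := by
    gcongr
  have h₂ : X ^ 2 * ((b - a) * (a * (h + g * a) + g * (1 + a))) ≤
      X ^ 2 * ((b - a) * (a * (h + h * a) + h * (1 + a))) := by
    gcongr
  have h₃ : X * (((1 + a) ^ 3 + g * (1 + a) * (1 + b)) * (h * b + a + a * b)) ≤
      X * (((1 + a) ^ 3 + g * (1 + a) * (1 + b)) * (h * X)) := by
    gcongr; linarith
  have h₄ := mul_le_mul_of_nonneg_left (upper_poly ha hab hg hgh hh) hX0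
  have h₅ : (b - a) * (1 + g) * (a * (h + g * a) - (1 + a) * (h * b + a + a * b)) ≤ 0 := by
    apply mul_nonpos_of_nonneg_of_nonpos (by positivity)
    have e1 : a * h ≤ b * h := by gcongr
    have e2 : a * (g * a) ≤ a * (1 * b) := by gcongr; linarith
    have e3 : 0 ≤ a * (h * b + a + a * b) := by positivity
    linarith
  linarith

theorem energy_upper {g h q x y x₁ x₂ : ℝ} (hg : 0 < g) (hgh : g ≤ h) (hh : h < 1)
    (hq : 0 < q) (hx : 1 - h < x)
    (h₁ : (x₁ - 1) * (q * x + y) = g * (x - 1) - h * (y - 1))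
    (h₂ : (x₂ - 1) * (q * x₁ + x) = g * (x₁ - 1) - h * (x - 1))
    (hy1 : 1 < y) (hx1 : 1 < x₁) :
    (x + g) * (x₁ - y) * ((1 - h) * (y - 1) - q * x * (x₁ - 1)) * x₂ +
      (x₁ + g) * (x₂ - x) * ((1 - h) * (x - 1) - q * x₁ * (x₂ - 1)) * y < 0 := by
  have hx0 : 0 < x := by linarith
  have hy0 : 0 < y := by linarith
  have hx10 : 0 < x₁ := by linarith
  have hD1 : 0 < q * x₁ + x := by positivity
  have hqx : 0 < q * x := by positivity
  have hh0 : 0 < h := by linarith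
  have hpos : 0 < (x₁ - 1) * (q * x + y) := mul_pos (by linarith) (by positivity)
  have hxy : y < x := by
    by_contra! hc
    have : g * (x - 1) ≤ g * (y - 1) := by gcongr
    have : g * (y - 1) ≤ h * (y - 1) := by gcongr
    linarith
  have hgX : g * (x - 1) ≤ h * (x - 1) := by gcongr; linarith
  have hxx1 : x₁ < x := by
    have e1 : (x₁ - 1) * 1 ≤ (x₁ - 1) * (q * x + y) := by gcongr; linarith
    have e2 : g * (x - 1) ≤ 1 * (x - 1) := by gcongr <;> linarith
    have e3 : 0 < h * (y - 1) := mul_pos (by linarith) (by linarith)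
    linarith
  have hx2 : x₂ < 1 := by
    by_contra! hc
    have e1 : 0 ≤ (x₂ - 1) * (q * x₁ + x) := mul_nonneg (by linarith) hD1.le
    have e2 : g * (x₁ - 1) < g * (x - 1) := by gcongr
    linarith
  have hx2D : x₂ * (q * x₁ + x) = h - g + (g + q) * x₁ + (1 - h) * x := by linarith
  have hx20 : 0 < x₂ := by
    have e1 : 0 < (g + q) * x₁ := by positivity
    have e2 : 0 < (1 - h) * x := mul_pos (by linarith) hx0
    exact pos_of_mul_pos_left (by rw [hx2D]; linarith) hD1.le
  have hqx2 : 0 < q * x₁ * (1 - x₂) := mul_pos (by positivity) (by linarith)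
  have hcX : 0 < (1 - h) * (x - 1) := mul_pos (by linarith) (by linarith)
  have hc : 0 < (x₁ + g) * (x - x₂) * y :=
    mul_pos (mul_pos (by linarith) (by linarith)) hy0
  have hX0 : 0 < x - 1 := by linarith
  have hY0 : 0 < y - 1 := by linarith
  have hh' : 0 < 1 - h := by linarith
  have hxx2 : 0 < x - x₂ := by linarith
  rcases le_or_gt ((x₁ - y) * ((1 - h) * (y - 1) - q * x * (x₁ - 1))) 0 with hle | hgt
  · have e1 : (x + g) * x₂ * ((x₁ - y) * ((1 - h) * (y - 1) - q * x * (x₁ - 1))) ≤ 0 :=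
      mul_nonpos_of_nonneg_of_nonpos (by positivity) hle
    have e2 : 0 < (x₁ + g) * (x - x₂) * y * ((1 - h) * (x - 1) + q * x₁ * (1 - x₂)) :=
      mul_pos hc (by linarith)
    linarith
  · rcases pos_and_pos_or_neg_and_neg_of_mul_pos hgt with ⟨ha, hb⟩ | ⟨ha, hb⟩
    · have e1 : (x₁ - y) * x₂ ≤ (x - x₂) * y := by
        have : x₁ * x₂ ≤ x * y := by gcongr; linarith
        linarith
      have e2 : (x + g) * (y - 1) ≤ (x₁ + g) * (x - 1) := by
        have : (x - 1) * (y - 1) ≤ (x - 1) * (x₁ - 1) := by gcongr; linarith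
        have : (1 + g) * (y - 1) ≤ (1 + g) * (x - 1) := by gcongr
        linarith
      have e3 : 0 < q * x * (x₁ - 1) := mul_pos hqx (by linarith)
      have e4 : (x + g) * (x₁ - y) * ((1 - h) * (y - 1) - q * x * (x₁ - 1)) * x₂ ≤
          (x + g) * (x₁ - y) * ((1 - h) * (y - 1)) * x₂ := by
        gcongr; linarith
      have e5 : (1 - h) * ((x₁ - y) * x₂) * ((x + g) * (y - 1)) ≤
          (1 - h) * ((x - x₂) * y) * ((x₁ + g) * (x - 1)) := by
        gcongr
      have e6 := mul_pos hc hqx2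
      linarith
    · have hyx1 : 0 < y - x₁ := by linarith
      set G := q * x * (x₁ - 1) - (1 - h) * (y - 1) with hG
      have hG0 : 0 < G := by linarith
      have hcY : 0 < (1 - h) * (y - 1) := mul_pos (by linarith) (by linarith)
      have hGeq : G = g * (x - 1) - (y - 1) - (x₁ - 1) * y := by linarith
      have hGle : G ≤ g * (x - 1) := by
        have : 0 < (x₁ - 1) * y := mul_pos (by linarith) hy0
        linarith
      have hYle : y - 1 ≤ g * (x - 1) := by
        have : 0 < (x₁ - 1) * y := mul_pos (by linarith) hy0
        linarith
      have p1 : (x + g) * (y - x₁) * G ≤ (x₁ + g) * (x - 1) * (x - 1) * y := by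
        have a1 : (x + g) * (y - x₁) * G ≤ (x + g) * (y - 1) * (g * (x - 1)) := by
          gcongr
        have a2 : (x - 1) * ((1 + g) * g * (y - 1)) ≤ (x - 1) * ((1 + g) * 1 * (g * (x - 1))) := by
          gcongr; linarith
        have a3 : g * (x - 1) * (x - 1) * (y - 1) ≤ (1 + g) * (x - 1) * (x - 1) * (y - 1) := by
          gcongr; linarith
        have a4 : g * ((1 + g) * (x - 1) * (x - 1)) ≤ 1 * ((1 + g) * (x - 1) * (x - 1)) := by
          gcongr; linarith
        have a5 : (1 + g) * ((x - 1) * (x - 1) * y) ≤ (x₁ + g) * ((x - 1) * (x - 1) * y) := by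
          gcongr
        linarith
      have p2 : (x + g) * (y - x₁) * ((h - g + (g + q) * x₁) * (x * (x₁ - 1))) ≤
          (x₁ + g) * (x - 1) * y * x₁ * (h * (x - 1) - g * (x₁ - 1)) := by
        have := upper_quadratic (a := x₁ - 1) (b := y - 1) (X := x - 1) (g := g) (h := h)
          (by linarith) (by linarith) (by linarith) hg.le hgh hh.le
          (by have : 0 < q * x * (x₁ - 1) := mul_pos hqx (by linarith)
              linarith)
        have e1 : g * (x - 1) - h * (y - 1) - (x₁ - 1) - (x₁ - 1) * (y - 1) =
          q * x * (x₁ - 1) := by linarith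
        rw [e1] at this
        linarith
      have p3 : (x + g) * (y - x₁) * (h - g + (g + q) * x₁) * G ≤
          (x + g) * (y - x₁) * (h - g + (g + q) * x₁) * (q * x * (x₁ - 1)) := by
        have : 0 < (g + q) * x₁ := by positivity
        have : 0 ≤ h - g + (g + q) * x₁ := by linarith
        gcongr
        linarith
      have p4 := mul_le_mul_of_nonneg_left p2 hq.le
      have p5 := mul_le_mul_of_nonneg_left p1 (mul_nonneg (sub_nonneg.2 hh.le) hx0.le)
      have p6 : 0 ≤ (x₁ + g) * y * ((1 - h) * (x - 1)) * (x - 1) * (q * x₁) := by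
        have : 0 ≤ x - 1 := by linarith
        positivity
      have p7 : (x + g) * (y - x₁) * G * (x₂ * (q * x₁ + x)) ≤
          (x₁ + g) * y * (x - 1) * ((1 - h) * (x - 1) + q * x₁ * (1 - x₂)) * (q * x₁ + x) := by
        have e1 : (1 - x₂) * (q * x₁ + x) = h * (x - 1) - g * (x₁ - 1) := by linarith
        have e2 : (x₁ + g) * y * (x - 1) * ((1 - h) * (x - 1) + q * x₁ * (1 - x₂)) * (q * x₁ + x)
          = (x₁ + g) * y * (x - 1) * ((1 - h) * (x - 1) * (q * x₁ + x) +
            q * x₁ * ((1 - x₂) * (q * x₁ + x))) := by ring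
        rw [hx2D, e2, e1]
        linarith
      have p8 : (x + g) * (y - x₁) * G * x₂ ≤
          (x₁ + g) * y * (x - 1) * ((1 - h) * (x - 1) + q * x₁ * (1 - x₂)) :=
        le_of_mul_le_mul_right (by linarith) hD1
      have p9 : (x₁ + g) * y * ((1 - h) * (x - 1) + q * x₁ * (1 - x₂)) * (x - 1) <
          (x₁ + g) * y * ((1 - h) * (x - 1) + q * x₁ * (1 - x₂)) * (x - x₂) := by
        apply mul_lt_mul_of_pos_left (by linarith)
        exact mul_pos (by positivity) (by linarith)
      have hGS : (1 - h) * (y - 1) - q * x * (x₁ - 1) = - G := by rw [hG]; ring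
      rw [hGS]
      linarith

theorem IsCompact.exists_ultrafilter_tendsto_add {X : Type*} [TopologicalSpace X] [T2Space X]
    {K : Set X} (hK : IsCompact K) {u : ℕ → X} (hu : ∀ n, u n ∈ K) {ℓ : X}
    (hℓ : MapClusterPt ℓ atTop u) (N : ℕ) :
    ∃ (U : Ultrafilter ℕ) (z : ℕ → X), (U : Filter ℕ) ≤ atTop ∧ z N = ℓ ∧
      ∀ k, z k ∈ K ∧ Tendsto (fun n => u (n + k)) U (𝓝 (z k)) := by
  obtain ⟨U₀, hU₀, hlim⟩ := mapClusterPt_iff_ultrafilter.1 hℓ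
  have hU : ((U₀.map (· - N) : Ultrafilter ℕ) : Filter ℕ) ≤ atTop :=
    (tendsto_sub_atTop_nat N).mono_left hU₀
  have hex : ∀ k, ∃ a ∈ K, Tendsto (fun n => u (n + k)) (U₀.map (· - N) : Ultrafilter ℕ) (𝓝 a) := by
    intro k
    have := isCompact_iff_ultrafilter_le_nhds.1 hK ((U₀.map (· - N)).map fun n => u (n + k))
      (le_principal_iff.2 (univ_mem' (f := (U₀ : Filter ℕ)) fun n => hu (n - N + k)))
    exact this
  choose z hzK hz using hex
  refine ⟨U₀.map (· - N), z, hU, ?_, fun k => ⟨hzK k, hz k⟩⟩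
  have h₁ : Tendsto (fun n => u (n - N + N)) U₀ (𝓝 (z N)) := hz N
  refine tendsto_nhds_unique (h₁.congr' ?_) hlim
  filter_upwards [hU₀ (eventually_ge_atTop N)] with n hn
  rw [Nat.sub_add_cancel hn]

/-- An energy for the recursion normalized to have equilibrium `1`; along solutions it decreases
after one or two steps. -/
noncomputable def lyapunov (g x y : ℝ) : ℝ := (1 - g + g * (x + y)) * (1 + g / x) * (1 + g / y)

theorem lyapunov_sub {g x y x₁ : ℝ} (hx : x ≠ 0) (hy : y ≠ 0) (hx₁ : x₁ ≠ 0) :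
    lyapunov g x₁ x - lyapunov g x y =
      g * (x + g) * ((x₁ - y) * (x₁ * y - (1 - g + g * x))) / (x * x₁ * y) := by
  unfold lyapunov
  field_simp
  ring

theorem lyapunov_step {g h q x y x₁ x₂ : ℝ} (hg : 0 < g) (hgh : g ≤ h) (hh : h < 1)
    (hq : 0 < q) (hq1 : q ≤ 1) (hx : 1 - h < x) (hy : 1 - h < y)
    (hx₁ : 1 - h < x₁) (hx₂ : 1 - h < x₂)
    (h₁ : x₁ * (q * x + y) = h - g + (g + q) * x + (1 - h) * y)
    (h₂ : x₂ * (q * x₁ + x) = h - g + (g + q) * x₁ + (1 - h) * x) :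
    (y = 1 ∧ x = 1) ∨ lyapunov g x₁ x < lyapunov g x y ∨
      lyapunov g x₂ x₁ < lyapunov g x y := by
  have hx0 : 0 < x := by linarith
  have hy0 : 0 < y := by linarith
  have hx10 : 0 < x₁ := by linarith
  have hx20 : 0 < x₂ := by linarith
  have hc : 0 < 1 - h := by linarith
  have hS : x₁ * y - (1 - g + g * x) = (1 - h) * (y - 1) - q * x * (x₁ - 1) := by linarith
  have hS' : x₂ * x - (1 - g + g * x₁) = (1 - h) * (x - 1) - q * x₁ * (x₂ - 1) := by linarith
  have d₁ := lyapunov_sub (g := g) hx0.ne' hy0.ne' hx10.ne'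
  have d₂ := lyapunov_sub (g := g) hx10.ne' hx0.ne' hx20.ne'
  rw [hS] at d₁
  rw [hS'] at d₂
  rcases le_or_gt ((y - 1) * (x₁ - 1)) 0 with hle | hgt
  · by_cases hone : y = 1 ∧ x₁ = 1
    · obtain ⟨rfl, rfl⟩ := hone
      left
      refine ⟨rfl, ?_⟩
      have : g * (x - 1) = 0 := by linarith
      rcases mul_eq_zero.1 this with h | h <;> linarith
    · right; left
      have hneg : (x₁ - y) * ((1 - h) * (y - 1) - q * x * (x₁ - 1)) < 0 := by
        have hqx : 0 < q * x := by positivity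
        rcases mul_nonpos_iff.1 hle with ⟨ha, hb⟩ | ⟨ha, hb⟩
        · have e1 : 0 ≤ (1 - h) * (y - 1) := by positivity
          have e2 : 0 ≤ q * x * (1 - x₁) := mul_nonneg hqx.le (by linarith)
          have e4 : 0 < 1 - x₁ ∨ 0 < y - 1 := by
            by_contra! hcon
            exact hone ⟨by linarith, by linarith⟩
          apply mul_neg_of_neg_of_pos
          · rcases e4 with h | h <;> linarith
          · rcases e4 with h | h
            · have := mul_pos hqx h
              linarith
            · have := mul_pos hc h
              linarith
        · have e1 : 0 ≤ (1 - h) * (1 - y) := mul_nonneg hc.le (by linarith)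
          have e2 : 0 ≤ q * x * (x₁ - 1) := mul_nonneg hqx.le (by linarith)
          have e4 : 0 < x₁ - 1 ∨ 0 < 1 - y := by
            by_contra! hcon
            exact hone ⟨by linarith, by linarith⟩
          apply mul_neg_of_pos_of_neg
          · rcases e4 with h | h <;> linarith
          · rcases e4 with h | h
            · have := mul_pos hqx h
              linarith
            · have := mul_pos hc h
              linarith
      have : g * (x + g) * ((x₁ - y) * ((1 - h) * (y - 1) - q * x * (x₁ - 1))) / (x * x₁ * y) < 0 :=
        div_neg_of_neg_of_pos (mul_neg_of_pos_of_neg (by positivity) hneg) (by positivity)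
      linarith
  · right; right
    have hE : (x + g) * (x₁ - y) * ((1 - h) * (y - 1) - q * x * (x₁ - 1)) * x₂ +
        (x₁ + g) * (x₂ - x) * ((1 - h) * (x - 1) - q * x₁ * (x₂ - 1)) * y < 0 := by
      rcases pos_and_pos_or_neg_and_neg_of_mul_pos hgt with ⟨ha, hb⟩ | ⟨ha, hb⟩
      · exact energy_upper hg hgh hh hq hx (by linarith) (by linarith) (by linarith) (by linarith)
      · exact energy_lower hg hgh hh hq hq1 hx hy (by linarith) (by linarith) (by linarith)
          (by linarith) hx₁
    have hsum : lyapunov g x₂ x₁ - lyapunov g x y = g / (x * x₁ * y * x₂) *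
        ((x + g) * (x₁ - y) * ((1 - h) * (y - 1) - q * x * (x₁ - 1)) * x₂ +
        (x₁ + g) * (x₂ - x) * ((1 - h) * (x - 1) - q * x₁ * (x₂ - 1)) * y) := by
      have : lyapunov g x₂ x₁ - lyapunov g x y =
        (lyapunov g x₂ x₁ - lyapunov g x₁ x) + (lyapunov g x₁ x - lyapunov g x y) := by ring
      rw [this, d₁, d₂]
      field_simp
      ring
    have : g / (x * x₁ * y * x₂) *
        ((x + g) * (x₁ - y) * ((1 - h) * (y - 1) - q * x * (x₁ - 1)) * x₂ +
        (x₁ + g) * (x₂ - x) * ((1 - h) * (x - 1) - q * x₁ * (x₂ - 1)) * y) < 0 :=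
      mul_neg_of_pos_of_neg (by positivity) hE
    linarith

theorem tendsto_one_of_lyapunov {g h q b : ℝ} (hg : 0 < g) (hgh : g ≤ h) (hh : h < 1)
    (hq : 0 < q) (hq1 : q ≤ 1) {w : ℕ → ℝ} (hw : ∀ n, 1 - h < w n) (hb : ∀ n, w n ≤ b)
    (hrec : ∀ n, w (n + 2) * (q * w (n + 1) + w n) =
      h - g + (g + q) * w (n + 1) + (1 - h) * w n) :
    Tendsto w atTop (𝓝 1) := by
  have hc : 0 < 1 - h := by linarith
  have hw0 : ∀ n, 0 < w n := fun n => hc.trans (hw n)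
  set v : ℕ → ℝ := fun n => lyapunov g (w (n + 1)) (w n) with hv
  have hstep : ∀ n, v (n + 1) ≤ v n ∨ v (n + 2) ≤ v n := by
    intro n
    rcases lyapunov_step hg hgh hh hq hq1 (hw (n + 1)) (hw n) (hw (n + 2)) (hw (n + 3))
      (hrec n) (hrec (n + 1)) with ⟨ha, hb⟩ | h | h
    · left
      have := hrec n
      rw [ha, hb] at this
      have h2 : w (n + 2) = 1 := by
        have : (w (n + 2) - 1) * (q + 1) = 0 := by linarith
        rcases mul_eq_zero.1 this with h | h <;> linarith
      have h2' : w (n + 1 + 1) = 1 := h2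
      simp [hv, ha, hb, h2']
    · exact Or.inl h.le
    · exact Or.inr h.le
  have hanti : Antitone fun n => min (v n) (v (n + 1)) := by
    refine antitone_nat_of_succ_le fun n => le_min ?_ (min_le_left _ _)
    rcases hstep n with h | h
    · exact (min_le_left _ _).trans h
    · exact (min_le_right _ _).trans h
  have hvpos : ∀ n, 0 ≤ v n := fun n => by
    have h1 := hw0 n
    have h2 := hw0 (n + 1)
    have h3 : 0 ≤ 1 - g + g * (w (n + 1) + w n) := by
      have : 0 < g * (w (n + 1) + w n) := by positivity
      linarith
    simp only [hv, lyapunov]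
    positivity
  obtain ⟨W, hW⟩ : ∃ W, Tendsto (fun n => min (v n) (v (n + 1))) atTop (𝓝 W) :=
    ⟨_, tendsto_atTop_ciInf hanti ⟨0, by rintro _ ⟨n, rfl⟩; exact le_min (hvpos _) (hvpos _)⟩⟩
  refine IsCompact.tendsto_nhds_of_unique_mapClusterPt (s := Icc (1 - h) b) isCompact_Icc
    (Eventually.of_forall fun n => ⟨(hw n).le, hb n⟩) ?_
  intro ℓ _ hℓ
  obtain ⟨U, z, hU, hz, hlim⟩ := isCompact_Icc.exists_ultrafilter_tendsto_add
    (fun n => (⟨(hw n).le, hb n⟩ : w n ∈ Icc (1 - h) b)) hℓ 4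
  have hz0 : ∀ k, 0 < z k := fun k => hc.trans_le (hlim k).1.1
  have hzrec : ∀ k, z (k + 2) * (q * z (k + 1) + z k) =
      h - g + (g + q) * z (k + 1) + (1 - h) * z k := by
    intro k
    refine tendsto_nhds_unique ((((hlim (k + 2)).2.mul (((hlim (k + 1)).2.const_mul q).add
      (hlim k).2))).congr fun n => hrec (n + k)) ?_
    exact (((hlim (k + 1)).2.const_mul _).const_add _).add ((hlim k).2.const_mul _)
  have hzc : ∀ k, 1 - h < z (k + 2) := by
    intro k
    have h0 := hz0 k
    have h1 := hz0 (k + 1)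
    refine lt_of_mul_lt_mul_right (a := q * z (k + 1) + z k) ?_ (by positivity)
    rw [hzrec]
    have : 0 < g * z (k + 1) := by positivity
    have : 0 < h * (q * z (k + 1)) := mul_pos (by linarith) (by positivity)
    linarith
  set vz : ℕ → ℝ := fun n => lyapunov g (z (n + 1)) (z n) with hvz
  have hvlim : ∀ k, Tendsto (fun n => v (n + k)) U (𝓝 (vz k)) := by
    intro k
    have l1 : Tendsto (fun n => w (n + k + 1)) U (𝓝 (z (k + 1))) := (hlim (k + 1)).2
    have l0 := (hlim k).2
    exact ((((l1.add l0).const_mul g).const_add (1 - g)).mul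
      ((tendsto_const_nhds.div l1 (hz0 _).ne').const_add 1)).mul
        ((tendsto_const_nhds.div l0 (hz0 _).ne').const_add 1)
  have hmin : ∀ k, min (vz k) (vz (k + 1)) = W := fun k =>
    tendsto_nhds_unique ((hvlim k).min (hvlim (k + 1)))
      ((hW.comp (tendsto_add_atTop_nat k)).mono_left hU)
  have hone : ∀ k, vz (k + 2) = W → z (k + 2) = 1 ∧ z (k + 3) = 1 := by
    intro k hk
    have m1 : W ≤ vz (k + 3) := by rw [← hmin (k + 2)]; exact min_le_right _ _
    have m2 : W ≤ vz (k + 4) := by rw [← hmin (k + 3)]; exact min_le_right _ _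
    rcases lyapunov_step hg hgh hh hq hq1 (hzc (k + 1)) (hzc k) (hzc (k + 2)) (hzc (k + 3))
      (hzrec (k + 2)) (hzrec (k + 3)) with h | h | h
    · exact h
    · exact absurd (hk ▸ h : vz (k + 3) < W) m1.not_gt
    · exact absurd (hk ▸ h : vz (k + 4) < W) m2.not_gt
  rw [← hz]
  rcases min_choice (vz 2) (vz 3) with h | h
  · obtain ⟨h2, h3⟩ := hone 0 (by rw [← hmin 2, h])
    have := hzrec 2
    norm_num at h2 h3 this
    rw [h2, h3] at this
    have : (z 4 - 1) * (q + 1) = 0 := by linarith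
    rcases mul_eq_zero.1 this with h | h <;> linarith
  · exact (hone 1 (by rw [← hmin 2, h])).2

/-- The right-hand side of the recursion, as a function of the current term `x` and the delayed
term `y`. -/
noncomputable def ratMap (p q r x y : ℝ) : ℝ := (r + p * x + y) / (q * x + y)

section Monotonicity

variable {p q r x x' y y' : ℝ}

theorem ratMap_sub_left (hq : 0 < q) (hx : 0 < x) (hx' : 0 < x') (hy : 0 < y) :
    ratMap p q r x y - ratMap p q r x' y =
      (x' - x) * (q * r + (q - p) * y) / ((q * x + y) * (q * x' + y)) := by
  have h₁ : q * x + y ≠ 0 := by positivity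
  have h₂ : q * x' + y ≠ 0 := by positivity
  unfold ratMap
  field_simp
  ring

theorem ratMap_sub_right (hq : 0 < q) (hx : 0 < x) (hy : 0 < y) (hy' : 0 < y') :
    ratMap p q r x y - ratMap p q r x y' =
      (y - y') * ((q - p) * x - r) / ((q * x + y) * (q * x + y')) := by
  have h₁ : q * x + y ≠ 0 := by positivity
  have h₂ : q * x + y' ≠ 0 := by positivity
  unfold ratMap
  field_simp
  ring

theorem ratMap_left_anti (hq : 0 < q) (hx : 0 < x) (hy : 0 < y) (h : x ≤ x')
    (hs : 0 ≤ q * r + (q - p) * y) : ratMap p q r x' y ≤ ratMap p q r x y := by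
  have hx' := hx.trans_le h
  rw [← sub_nonneg, ratMap_sub_left hq hx hx' hy]
  exact div_nonneg (mul_nonneg (sub_nonneg.2 h) hs) (by positivity)

theorem ratMap_left_mono (hq : 0 < q) (hx : 0 < x) (hy : 0 < y) (h : x ≤ x')
    (hs : q * r + (q - p) * y ≤ 0) : ratMap p q r x y ≤ ratMap p q r x' y := by
  have hx' := hx.trans_le h
  rw [← sub_nonpos, ratMap_sub_left hq hx hx' hy]
  exact div_nonpos_of_nonpos_of_nonneg
    (mul_nonpos_of_nonneg_of_nonpos (sub_nonneg.2 h) hs) (by positivity)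

theorem ratMap_right_mono (hq : 0 < q) (hx : 0 < x) (hy : 0 < y) (h : y ≤ y')
    (hs : r ≤ (q - p) * x) : ratMap p q r x y ≤ ratMap p q r x y' := by
  have hy' := hy.trans_le h
  rw [← sub_nonneg, ratMap_sub_right hq hx hy' hy]
  exact div_nonneg (mul_nonneg (sub_nonneg.2 h) (sub_nonneg.2 hs)) (by positivity)

theorem ratMap_right_anti (hq : 0 < q) (hx : 0 < x) (hy : 0 < y) (h : y ≤ y')
    (hs : (q - p) * x ≤ r) : ratMap p q r x y' ≤ ratMap p q r x y := by
  have hy' := hy.trans_le h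
  rw [← sub_nonpos, ratMap_sub_right hq hx hy' hy]
  exact div_nonpos_of_nonpos_of_nonneg
    (mul_nonpos_of_nonneg_of_nonpos (sub_nonneg.2 h) (sub_nonpos.2 hs)) (by positivity)

theorem le_ratMap_iff (hq : 0 < q) (hx : 0 < x) (hy : 0 < y) {c : ℝ} :
    c ≤ ratMap p q r x y ↔ c * (q * x + y) ≤ r + p * x + y :=
  le_div_iff₀ (by positivity)

theorem ratMap_le_iff (hq : 0 < q) (hx : 0 < x) (hy : 0 < y) {c : ℝ} :
    ratMap p q r x y ≤ c ↔ r + p * x + y ≤ c * (q * x + y) :=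
  div_le_iff₀ (by positivity)

theorem quadratic_nonneg_mono {L : ℝ} (hq : 0 < q) (hL : (q + 1) * L ^ 2 - (p + 1) * L - r < 0)
    (hLx : L ≤ x) (hxx' : x ≤ x') (hx : 0 ≤ (q + 1) * x ^ 2 - (p + 1) * x - r) :
    p + 1 < (q + 1) * (x + L) ∧ 0 ≤ (q + 1) * x' ^ 2 - (p + 1) * x' - r := by
  have h₁ : p + 1 < (q + 1) * (x + L) := by
    by_contra! hc
    have : 0 ≤ (x - L) * (p + 1 - (q + 1) * (x + L)) :=
      mul_nonneg (by linarith) (by linarith)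
    linarith
  refine ⟨h₁, ?_⟩
  have h₂ : (q + 1) * (x + L) ≤ (q + 1) * (x' + x) := by gcongr ?_ * ?_; linarith
  have : 0 ≤ (x' - x) * ((q + 1) * (x' + x) - (p + 1)) := mul_nonneg (by linarith) (by linarith)
  linarith

theorem quadratic_eq_of_le {L : ℝ} (hq : 0 < q) (hL : (q + 1) * L ^ 2 - (p + 1) * L - r < 0)
    (hLx : L ≤ x) (hxx' : x ≤ x') (hx : 0 ≤ (q + 1) * x ^ 2 - (p + 1) * x - r)
    (hx' : (q + 1) * x' ^ 2 - (p + 1) * x' - r ≤ 0) : x = x' := by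
  have h₁ := (quadratic_nonneg_mono hq hL hLx le_rfl hx).1
  have h₂ : (q + 1) * (x + L) ≤ (q + 1) * (x' + x) := by gcongr ?_ * ?_; linarith
  by_contra hne
  have : 0 < (x' - x) * ((q + 1) * (x' + x) - (p + 1)) :=
    mul_pos (sub_pos.2 (lt_of_le_of_ne hxx' hne)) (by linarith)
  linarith

end Monotonicity

/-- `Λ` behaves like the set of cluster points of a bounded solution of
`y (n + 2) = f (y (n + 1)) (y n)`, with smallest element `m` and largest element `M`: each point extends to a backward orbit of length
three and to a forward step inside `Λ`. -/
structure IsLimitRange (f : ℝ → ℝ → ℝ) (Λ : Set ℝ) (m M : ℝ) : Prop where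
  isLeast : IsLeast Λ m
  isGreatest : IsGreatest Λ M
  backward : ∀ x ∈ Λ, ∃ a ∈ Λ, ∃ b ∈ Λ, ∃ d ∈ Λ, x = f a b ∧ a = f b d
  forward : ∀ x ∈ Λ, ∃ d ∈ Λ, f x d ∈ Λ

theorem exists_isLimitRange {f : ℝ → ℝ → ℝ} {y : ℕ → ℝ} {L b : ℝ} (hy : ∀ n, y n ∈ Icc L b)
    (hf : ∀ x ∈ Icc L b, ∀ y ∈ Icc L b, ContinuousAt (fun z : ℝ × ℝ => f z.1 z.2) (x, y))
    (hrec : ∀ n, y (n + 2) = f (y (n + 1)) (y n)) :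
    ∃ m M, L ≤ m ∧ m ≤ M ∧ IsLimitRange f {x | MapClusterPt x atTop y} m M ∧
      (∀ K < m, ∀ᶠ n in atTop, K < y n) ∧ (m = M → Tendsto y atTop (𝓝 m)) := by
  set Λ := {x | MapClusterPt x atTop y} with hΛ
  have hsub : Λ ⊆ Icc L b := fun x hx =>
    isClosed_Icc.mem_of_mapClusterPt hx (Eventually.of_forall hy)
  have hne : Λ.Nonempty := by
    obtain ⟨x, _, hx⟩ := isCompact_Icc.exists_mapClusterPt (f := atTop) (u := y)
      (by simpa using ⟨0, fun n _ => hy n⟩)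
    exact ⟨x, hx⟩
  have hcl : IsClosed Λ := isClosed_setOfPred_clusterPt
  have hcpt : IsCompact Λ := isCompact_Icc.of_isClosed_subset hcl hsub
  obtain ⟨m, hm⟩ := hcpt.exists_isLeast hne
  obtain ⟨M, hM⟩ := hcpt.exists_isGreatest hne
  have hchain : ∀ x ∈ Λ, ∀ N, ∃ z : ℕ → ℝ, z N = x ∧ (∀ k, z k ∈ Λ) ∧
      ∀ k, z (k + 2) = f (z (k + 1)) (z k) := by
    intro x hx N
    obtain ⟨U, z, hU, hz, hlim⟩ := isCompact_Icc.exists_ultrafilter_tendsto_add hy hx N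
    refine ⟨z, hz, fun k => ?_, fun k => ?_⟩
    · refine mapClusterPt_iff_ultrafilter.2 ⟨U.map (· + k), ?_, (hlim k).2⟩
      exact (tendsto_add_atTop_nat k).mono_left hU
    · refine tendsto_nhds_unique (hlim (k + 2)).2 ?_
      have := (hf _ (hlim (k + 1)).1 _ (hlim k).1).tendsto.comp
        ((hlim (k + 1)).2.prodMk_nhds (hlim k).2)
      exact this.congr fun n => (hrec (n + k)).symm
  refine ⟨m, M, (hsub hm.1).1, hm.2 hM.1, ⟨hm, hM, fun x hx => ?_, fun x hx => ?_⟩,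
    fun K hK => ?_, fun h => ?_⟩
  · obtain ⟨z, hz, hzΛ, hzr⟩ := hchain x hx 3
    exact ⟨z 2, hzΛ _, z 1, hzΛ _, z 0, hzΛ _, by rw [← hz, hzr 1], hzr 0⟩
  · obtain ⟨z, hz, hzΛ, hzr⟩ := hchain x hx 1
    exact ⟨z 0, hzΛ _, by rw [← hz, ← hzr 0]; exact hzΛ _⟩
  · by_contra hcon
    rw [not_eventually] at hcon
    obtain ⟨x, hx, hxc⟩ := isCompact_Icc.exists_mapClusterPt_of_frequently
      (s := Icc L K) (f := y) (hcon.mono fun n hn => ⟨(hy n).1, not_lt.1 hn⟩)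
    exact absurd (hm.2 hxc) (not_le.2 (hx.2.trans_lt hK))
  · refine isCompact_Icc.tendsto_nhds_of_unique_mapClusterPt (Eventually.of_forall hy) ?_
    intro x _ hx
    exact le_antisymm (h ▸ hM.2 hx) (hm.2 hx)

namespace IsLimitRange

variable {f : ℝ → ℝ → ℝ} {Λ : Set ℝ} {m M : ℝ}

theorem le_upper (H : IsLimitRange f Λ m M) : m ≤ M := H.isGreatest.2 H.isLeast.1

theorem eq_of_product_kernel {φ : ℝ → ℝ → ℝ} {e : ℝ}
    (H : IsLimitRange (fun x y => x * φ x y) Λ m M) (hm : 0 < m) (he : 0 < e) (hφe : φ e e = 1)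
    (hφ : ∀ x y, 0 < x → 0 < y → 0 < φ x y)
    (hφl : ∀ x x' y, 0 < x → x < x' → 0 < y → φ x' y < φ x y)
    (hφr : ∀ x y y', 0 < x → 0 < y → y ≤ y' → φ x y' ≤ φ x y)
    (hmono : ∀ x x' y, 0 < x → x ≤ x' → 0 < y → x * φ x y ≤ x' * φ x' y)
    (hdiag : ∀ x x', 0 < x → x < x' → x * φ x x < x' * φ x' x') : m = M := by
  have hpos : ∀ x ∈ Λ, 0 < x := fun x hx => hm.trans_le (H.isLeast.2 hx)
  have hmM := H.le_upper
  have hM : 0 < M := hm.trans_le hmM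
  have hφl' : ∀ x x' y, 0 < x → x ≤ x' → 0 < y → φ x' y ≤ φ x y := fun x x' y hx hxx hy =>
    hxx.eq_or_lt.elim (fun h => h ▸ le_rfl) fun h => (hφl x x' y hx h hy).le
  have hdiag' : ∀ x x', 0 < x → x ≤ x' → x * φ x x ≤ x' * φ x' x' := fun x x' hx hxx =>
    hxx.eq_or_lt.elim (fun h => h ▸ le_rfl) fun h => (hdiag x x' hx h).le
  have below : ∀ x, 0 < x → x ≤ e → x ≤ x * φ x x := fun x hx hxe => by
    have h : 1 ≤ φ x x := hφe ▸ (hφr e x e he hx hxe).trans (hφl' x e x hx hxe hx)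
    exact le_mul_of_one_le_right hx.le h
  have above : ∀ x, e ≤ x → x * φ x x ≤ x := fun x hxe => by
    have hx := he.trans_le hxe
    have h : φ x x ≤ 1 := hφe ▸ (hφr x e x hx he hxe).trans (hφl' e x e he hxe he)
    exact mul_le_of_le_one_right hx.le h
  have below_of : ∀ x, 0 < x → x ≤ x * φ x x → x ≤ e := fun x hx h => by
    by_contra! hc
    have h₁ : φ x x < 1 := hφe ▸ (hφr x e x hx he hc.le).trans_lt (hφl e x e he hc he)
    exact absurd h (not_le.2 (mul_lt_of_lt_one_right hx h₁))
  have above_of : ∀ x, 0 < x → x * φ x x ≤ x → e ≤ x := fun x hx h => by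
    by_contra! hc
    have h₁ : 1 < φ x x := hφe ▸ (hφr e x e he hx hc.le).trans_lt (hφl x e x hx hc hx)
    exact absurd h (not_le.2 (lt_mul_of_one_lt_right hx h₁))
  have upper : m * M ≤ e * (m * φ m m) := by
    rcases le_or_gt M e with hMe | hMe
    · calc m * M ≤ (m * φ m m) * e := by
            gcongr
            · exact mul_nonneg hm.le (hφ m m hm hm).le
            · exact below m hm (hmM.trans hMe)
        _ = _ := by ring
    obtain ⟨a, ha, b, hb, d, hd, hMab, habd⟩ := H.backward M H.isGreatest.1
    have ha0 := hpos a ha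
    have hb0 := hpos b hb
    have key : a ≤ b → False := by
      intro hab
      have h₁ : M ≤ b * φ b b := by
        have := hmono a b b ha0 hab hb0
        exact hMab.trans_le this
      have hMM : M ≤ M * φ M M := h₁.trans (hdiag' b M hb0 (H.isGreatest.2 hb))
      exact absurd (below_of M hM hMM) (not_le.2 hMe)
    have hab1 : 1 ≤ φ a b := by
      by_contra! hc
      have : M < a := by
        rw [hMab]
        exact mul_lt_of_lt_one_right ha0 hc
      exact absurd (H.isGreatest.2 ha) (not_le.2 this)
    rcases le_or_gt e b with hbe | hbe
    · have hae : a ≤ e := by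
        by_contra! hc
        have : φ a b < 1 := hφe ▸ (hφr a e b ha0 he hbe).trans_lt (hφl e a e he hc he)
        linarith
      exact (key (hae.trans hbe)).elim
    have hab : a ≤ b * φ b m := by
      have h₁ := hφr b m d hb0 hm (H.isLeast.2 hd)
      have h₂ : a = b * φ b d := habd
      rw [h₂]
      gcongr
    have hbm : 1 < φ b m := by
      by_contra! hc
      exact key (hab.trans (mul_le_of_le_one_right hb0.le hc))
    have h₁ : M ≤ (b * φ b m) * φ (b * φ b m) b := hMab.trans_le (hmono a _ b ha0 hab hb0)
    have h₂ : φ (b * φ b m) b ≤ φ b b :=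
      hφl' _ _ _ hb0 (le_mul_of_one_le_right hb0.le hbm.le) hb0
    have h₃ : b * φ b b ≤ e := by
      have := hdiag' b e hb0 hbe.le
      rwa [hφe, mul_one] at this
    have h₄ : φ b m ≤ φ m m := hφl' _ _ _ hm (H.isLeast.2 hb) hm
    have h₅ := (hφ b m hb0 hm).le
    have h₆ := (hφ m m hm hm).le
    have h₇ : 0 ≤ b * φ b b := (mul_pos hb0 (hφ b b hb0 hb0)).le
    calc m * M ≤ m * ((b * φ b m) * φ b b) := by
          gcongr
          exact h₁.trans (by gcongr)
      _ = m * (φ b m * (b * φ b b)) := by ring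
      _ ≤ m * (φ m m * e) := by gcongr
      _ = _ := by ring
  have lower : e * (M * φ M M) ≤ m * M := by
    rcases le_or_gt e m with hme | hme
    · have h := above M (hme.trans hmM)
      have h₀ : 0 ≤ M * φ M M := (mul_pos hM (hφ M M hM hM)).le
      gcongr
    obtain ⟨a, ha, b, hb, d, hd, hmab, habd⟩ := H.backward m H.isLeast.1
    have ha0 := hpos a ha
    have hb0 := hpos b hb
    have key : b ≤ a → False := by
      intro hab
      have h₁ : b * φ b b ≤ m := by
        have := hmono b a b hb0 hab hb0
        exact this.trans_eq hmab.symm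
      have hmm : m * φ m m ≤ m := (hdiag' m b hm (H.isLeast.2 hb)).trans h₁
      exact absurd (above_of m hm hmm) (not_le.2 hme)
    have hab1 : φ a b ≤ 1 := by
      by_contra! hc
      have : a < m := by
        rw [hmab]
        exact lt_mul_of_one_lt_right ha0 hc
      exact absurd (H.isLeast.2 ha) (not_le.2 this)
    rcases le_or_gt b e with hbe | hbe
    · have hae : e ≤ a := by
        by_contra! hc
        have : 1 < φ a b := hφe ▸ (hφr e b e he hb0 hbe).trans_lt (hφl a e b ha0 hc hb0)
        linarith
      exact (key (hbe.trans hae)).elim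
    have hab : b * φ b M ≤ a := by
      have h₁ := hφr b d M hb0 (hpos d hd) (H.isGreatest.2 hd)
      have h₂ : a = b * φ b d := habd
      rw [h₂]
      gcongr
    have hbM : φ b M < 1 := by
      by_contra! hc
      exact key ((le_mul_of_one_le_right hb0.le hc).trans hab)
    have h₀ := hφ b M hb0 hM
    have h₁ : (b * φ b M) * φ (b * φ b M) b ≤ m :=
      (hmono _ a b (mul_pos hb0 h₀) hab hb0).trans_eq hmab.symm
    have h₂ : φ b b ≤ φ (b * φ b M) b :=
      hφl' _ _ _ (mul_pos hb0 h₀) (mul_le_of_le_one_right hb0.le hbM.le) hb0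
    have h₃ : e ≤ b * φ b b := by
      have := hdiag' e b he hbe.le
      rwa [hφe, mul_one] at this
    have h₄ : φ M M ≤ φ b M := hφl' _ _ _ hb0 (H.isGreatest.2 hb) hM
    calc e * (M * φ M M) = M * (φ M M * e) := by ring
      _ ≤ M * (φ b M * (b * φ b b)) := by gcongr
      _ = ((b * φ b M) * φ b b) * M := by ring
      _ ≤ m * M := by
          gcongr
          exact le_trans (by gcongr) h₁
  refine hmM.eq_or_lt.elim id fun h => ?_
  have := mul_lt_mul_of_pos_left (hdiag m M hm h) he
  linarith

end IsLimitRange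

namespace IsLimitRange

theorem exists_eq_upper {f : ℝ → ℝ → ℝ} {Λ : Set ℝ} {m M : ℝ} (H : IsLimitRange f Λ m M) :
    ∃ a b, m ≤ a ∧ a ≤ M ∧ m ≤ b ∧ b ≤ M ∧ M = f a b := by
  obtain ⟨a, ha, b, hb, d, hd, h, -⟩ := H.backward M H.isGreatest.1
  exact ⟨a, b, H.isLeast.2 ha, H.isGreatest.2 ha, H.isLeast.2 hb, H.isGreatest.2 hb, h⟩

theorem exists_eq_lower {f : ℝ → ℝ → ℝ} {Λ : Set ℝ} {m M : ℝ} (H : IsLimitRange f Λ m M) :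
    ∃ a b, m ≤ a ∧ a ≤ M ∧ m ≤ b ∧ b ≤ M ∧ m = f a b := by
  obtain ⟨a, ha, b, hb, d, hd, h, -⟩ := H.backward m H.isLeast.1
  exact ⟨a, b, H.isLeast.2 ha, H.isGreatest.2 ha, H.isLeast.2 hb, H.isGreatest.2 hb, h⟩

variable {p q r L m M : ℝ} {Λ : Set ℝ}

theorem eq_or_of_pos_of_le (H : IsLimitRange (ratMap p q r) Λ m M) (hq : 0 < q) (hp : 0 < p)
    (hm : 0 < m) (hpq : p ≤ q) (hr : 0 < r) :
    m = M ∨ p < q ∧ r < (q - p) * m ∧ 0 < q * r + (q - p) * m := by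
  have hmM := H.le_upper
  have hM := hm.trans_le hmM
  have hqp : 0 ≤ q - p := sub_nonneg.2 hpq
  have hqr : 0 < q * r := mul_pos hq hr
  have hdec : ∀ y, 0 < y → 0 ≤ q * r + (q - p) * y := fun y hy => by positivity
  rcases lt_or_ge M 1 with h1 | h1
  · obtain ⟨d, hd, hfd⟩ := H.forward m H.isLeast.1
    have hd0 := hm.trans_le (H.isLeast.2 hd)
    have h : ratMap p q r m d ≤ M := H.isGreatest.2 hfd
    rw [ratMap_le_iff hq hm hd0] at h
    have h₂ : M * (q * m + d) ≤ 1 * (q * m + d) := by gcongr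
    have h₃ : r ≤ (q - p) * m := by linarith
    have h₄ : r < (q - p) * m := by
      have : M * (q * m + d) < 1 * (q * m + d) := by gcongr
      linarith
    have h₅ : 0 < q - p := by
      by_contra! hc
      have := mul_nonpos_of_nonpos_of_nonneg hc hm.le
      linarith
    exact Or.inr ⟨sub_pos.1 h₅, h₄, by positivity⟩
  left
  obtain ⟨a, b, ha, haM, hb, hbM, hab⟩ := H.exists_eq_upper
  have ha0 := hm.trans_le ha
  have hb0 := hm.trans_le hb
  have hM1 := (le_ratMap_iff hq ha0 hb0).1 hab.le
  have hsa : (q - p) * a ≤ r := by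
    have : 1 * (q * a + b) ≤ M * (q * a + b) := by gcongr
    linarith
  have hup : M ≤ ratMap p q r m m :=
    hab.le.trans <| (ratMap_right_anti hq ha0 hm hb hsa).trans
      (ratMap_left_anti hq hm hm ha (hdec m hm))
  rw [le_ratMap_iff hq hm hm] at hup
  obtain ⟨a, b, ha, haM, hb, hbM, hab⟩ := H.exists_eq_lower
  have ha0 := hm.trans_le ha
  have hb0 := hm.trans_le hb
  refine le_antisymm hmM ?_
  rcases le_total ((q - p) * a) r with hs | hs
  · have hlow : ratMap p q r M M ≤ m :=
      (ratMap_left_anti hq ha0 hM haM (hdec M hM)).trans <|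
        (ratMap_right_anti hq ha0 hb0 hbM hs).trans hab.ge
    rw [ratMap_le_iff hq hM hM] at hlow
    refine le_of_mul_le_mul_left (a := p + 1) ?_ (by linarith)
    linarith
  · have hlow : ratMap p q r M m ≤ m :=
      (ratMap_left_anti hq ha0 hm haM (hdec m hm)).trans <|
        (ratMap_right_mono hq ha0 hm hb hs).trans hab.ge
    rw [ratMap_le_iff hq hM hm] at hlow
    refine le_of_mul_le_mul_left (a := p + m) ?_ (by linarith)
    linarith

theorem eq_or_of_nonpos_of_le (H : IsLimitRange (ratMap p q r) Λ m M) (hq : 0 < q) (hp : 0 < p)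
    (hL : 0 < L) (hQ : (q + 1) * L ^ 2 - (p + 1) * L - r < 0) (hLm : L ≤ m)
    (hpq : p ≤ q) (hr : r ≤ 0) :
    m = M ∨ p < q ∧ r < (q - p) * m ∧ 0 < q * r + (q - p) * m := by
  have hm := hL.trans_le hLm
  have hmM := H.le_upper
  have hM := hm.trans_le hmM
  have hqp : 0 ≤ q - p := sub_nonneg.2 hpq
  have hinc : ∀ x, 0 < x → r ≤ (q - p) * x := fun x hx => hr.trans (mul_nonneg hqp hx.le)
  have hmul : (q - p) * m ≤ (q - p) * M := by gcongr
  rcases lt_or_ge 0 (q * r + (q - p) * m) with h2C | h2C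
  · have h₀ : q * r ≤ 0 := mul_nonpos_of_nonneg_of_nonpos hq.le hr
    have h₁ : 0 < (q - p) * m := by linarith
    exact Or.inr ⟨sub_pos.1 (pos_of_mul_pos_left h₁ hm.le), hr.trans_lt h₁, h2C⟩
  left
  obtain ⟨a, b, ha, haM, hb, hbM, hab⟩ := H.exists_eq_lower
  have ha0 := hm.trans_le ha
  have hb0 := hm.trans_le hb
  have hlow : ratMap p q r m m ≤ m :=
    (ratMap_left_mono hq hm hm ha h2C).trans <|
      (ratMap_right_mono hq ha0 hm hb (hinc a ha0)).trans hab.ge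
  rw [ratMap_le_iff hq hm hm] at hlow
  have hQm : 0 ≤ (q + 1) * m ^ 2 - (p + 1) * m - r := by linarith
  obtain ⟨a, b, ha, haM, hb, hbM, hab⟩ := H.exists_eq_upper
  have ha0 := hm.trans_le ha
  have hb0 := hm.trans_le hb
  have hup : M ≤ ratMap p q r a M := hab.le.trans (ratMap_right_mono hq ha0 hb0 hbM (hinc a ha0))
  rcases le_total (q * r + (q - p) * M) 0 with h2A | h2B
  · have hup' := hup.trans (ratMap_left_mono hq ha0 hM haM h2A)
    rw [le_ratMap_iff hq hM hM] at hup'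
    exact quadratic_eq_of_le hq hQ hLm hmM hQm (by linarith)
  · have hup' := hup.trans (ratMap_left_anti hq hm hM ha h2B)
    rw [le_ratMap_iff hq hm hM] at hup'
    have hv := (quadratic_nonneg_mono hq hQ hLm le_rfl hQm).1
    have hv' : (q + 1) * (m + L) ≤ (q + 1) * (m + m) := by gcongr
    refine hmM.eq_or_lt.elim id fun hlt => ?_
    exfalso
    have h₁ : q * m + M + m ≤ 1 := by
      refine le_of_mul_le_mul_left (a := M - m) ?_ (sub_pos.2 hlt)
      linarith
    have h₂ : (q + 2) * m < 1 := by linarith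
    have h₃ : (q + 2) * (p + 1) < 2 * (q + 1) := by
      have h₄ : (q + 2) * (p + 1) < (q + 2) * ((q + 1) * (m + m)) := by gcongr; linarith
      have h₅ : 2 * (q + 1) * ((q + 2) * m) < 2 * (q + 1) * 1 := by gcongr
      linarith
    have hdisc : 0 ≤ (p + 1) ^ 2 + 4 * (q + 1) * r := by
      have h₄ := sq_nonneg (2 * (q + 1) * L - (p + 1))
      have h₅ := mul_neg_of_pos_of_neg (a := 4 * (q + 1)) (by positivity) hQ
      linarith
    have h₄ : (q - p) * (p + 1) ≤ (q - p) * ((q + 1) * (m + m)) := by gcongr; linarith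
    have h₅ : 0 ≤ q * ((p + 1) ^ 2 + 4 * (q + 1) * r) := by positivity
    have h₆ : 0 ≤ (2 * (q + 1)) * -(q * r + (q - p) * m) :=
      mul_nonneg (by positivity) (by linarith)
    have h₇ : 2 * (q - p) ≤ q * (p + 1) := by
      refine le_of_mul_le_mul_left (a := p + 1) ?_ (by positivity)
      linarith
    linarith

theorem eq_or_of_nonneg_of_lt (H : IsLimitRange (ratMap p q r) Λ m M) (hq : 0 < q)
    (hm : 0 < m) (hpq : q < p) (hr : 0 ≤ r) {e : ℝ} (he : 0 < e)
    (hQe : (q + 1) * e ^ 2 - (p + 1) * e - r = 0) :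
    m = M ∨ q < 1 ∧ q * e < p := by
  have hmM := H.le_upper
  have hM := hm.trans_le hmM
  have ht : 0 < p - q := sub_pos.2 hpq
  have hdec : ∀ x, 0 < x → (q - p) * x ≤ r := fun x hx => by
    have : 0 < (p - q) * x := by positivity
    linarith
  have hmul : (p - q) * m ≤ (p - q) * M := by gcongr
  obtain ⟨a, b, ha, haM, hb, hbM, hab⟩ := H.exists_eq_upper
  obtain ⟨a', b', ha', haM', hb', hbM', hab'⟩ := H.exists_eq_lower
  have ha0 := hm.trans_le ha
  have hb0 := hm.trans_le hb
  have ha0' := hm.trans_le ha'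
  have hb0' := hm.trans_le hb'
  have hup : M ≤ ratMap p q r a m := hab.le.trans (ratMap_right_anti hq ha0 hm hb (hdec a ha0))
  have hlow : ratMap p q r a' M ≤ m :=
    (ratMap_right_anti hq ha0' hb0' hbM' (hdec a' ha0')).trans hab'.ge
  rcases le_total ((p - q) * m) (q * r) with h3A | h3B
  · left
    have hup' := hup.trans (ratMap_left_anti hq hm hm ha (by linarith))
    rw [le_ratMap_iff hq hm hm] at hup'
    refine le_antisymm hmM ?_
    rcases le_total ((p - q) * M) (q * r) with hs | hs
    · have hlow' := (ratMap_left_anti hq ha0' hM haM' (by linarith)).trans hlow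
      rw [ratMap_le_iff hq hM hM] at hlow'
      refine le_of_mul_le_mul_left (a := p + 1) ?_ (by linarith)
      linarith
    · have hlow' := (ratMap_left_mono hq hm hM ha' (by linarith)).trans hlow
      rw [ratMap_le_iff hq hm hM] at hlow'
      refine le_of_mul_le_mul_left (a := q * m + 1) ?_ (by positivity)
      linarith
  have hup' := hup.trans (ratMap_left_mono hq ha0 hm haM (by linarith))
  rw [le_ratMap_iff hq hM hm] at hup'
  have hlow' := (ratMap_left_mono hq hm hM ha' (by linarith)).trans hlow
  rw [ratMap_le_iff hq hm hM] at hlow'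
  by_cases hqe : q * e < p
  · rcases lt_or_ge q 1 with h1 | h1
    · exact Or.inr ⟨h1, hqe⟩
    refine Or.inl (hmM.eq_or_lt.elim id fun hlt => ?_)
    exfalso
    have h₁ : q * (M + m) ≤ p - 1 := by
      refine le_of_mul_le_mul_left (a := M - m) ?_ (sub_pos.2 hlt)
      linarith
    have h₂ : m * (q * (M + m)) ≤ m * (p - 1) := by gcongr
    have h₃ : 0 ≤ m * M * (q - 1) := mul_nonneg (by positivity) (by linarith)
    linarith
  · push Not at hqe
    refine Or.inl (le_antisymm hmM ?_)
    have h₁ : M ≤ e := by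
      have h₂ : ratMap p q r M m ≤ p / q := by
        rw [ratMap_le_iff hq hM hm, div_mul_eq_mul_div, le_div_iff₀ hq]
        linarith
      have h₃ : p / q ≤ e := by rwa [div_le_iff₀' hq]
      exact ((le_ratMap_iff hq hM hm).2 hup').trans (h₂.trans h₃)
    have h₂ : (p - q) * e ≤ q * r := by
      have : (q + 1) * e * p ≤ (q + 1) * e * (q * e) := by gcongr
      have h₃ : q * ((q + 1) * e ^ 2 - (p + 1) * e - r) = 0 := by rw [hQe, mul_zero]
      linarith
    exact h₁.trans (le_of_mul_le_mul_left (h₂.trans h3B) ht)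

theorem eq_of_neg_of_lt (H : IsLimitRange (ratMap p q r) Λ m M) (hq : 0 < q)
    (hL : 0 < L) (hL1 : L < 1) (hQ : (q + 1) * L ^ 2 - (p + 1) * L - r < 0) (hLm : L ≤ m)
    (hpq : q < p) (hr : r < 0) {e : ℝ} (hLe : L ≤ e)
    (hQe : (q + 1) * e ^ 2 - (p + 1) * e - r = 0) :
    m = M := by
  have hm := hL.trans_le hLm
  have hmM := H.le_upper
  have hM := hm.trans_le hmM
  have ht : 0 < p - q := sub_pos.2 hpq
  have hqr : q * r < 0 := mul_neg_of_pos_of_neg hq hr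
  have hinc : ∀ y, 0 < y → q * r + (q - p) * y ≤ 0 := fun y hy => by
    have : 0 < (p - q) * y := by positivity
    linarith
  have hmul : (p - q) * m ≤ (p - q) * M := by gcongr
  have hQm : (p - q) * m ≤ -r → 0 ≤ (q + 1) * m ^ 2 - (p + 1) * m - r := fun h => by
    obtain ⟨a, b, ha, haM, hb, hbM, hab⟩ := H.exists_eq_lower
    have ha0 := hm.trans_le ha
    have hb0 := hm.trans_le hb
    have hlow : ratMap p q r m m ≤ m :=
      (ratMap_right_mono hq hm hm hb (by linarith)).trans <|
        (ratMap_left_mono hq hm hb0 ha (hinc b hb0)).trans hab.ge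
    rw [ratMap_le_iff hq hm hm] at hlow
    linarith
  obtain ⟨a, b, ha, haM, hb, hbM, hab⟩ := H.exists_eq_upper
  have ha0 := hm.trans_le ha
  have hb0 := hm.trans_le hb
  have hup : M ≤ ratMap p q r M b := hab.le.trans (ratMap_left_mono hq ha0 hb0 haM (hinc b hb0))
  rcases le_total ((p - q) * M) (-r) with h4A | h4B
  · have hup' := hup.trans (ratMap_right_mono hq hM hb0 hbM (by linarith))
    rw [le_ratMap_iff hq hM hM] at hup'
    exact quadratic_eq_of_le hq hQ hLm hmM (hQm (hmul.trans h4A)) (by linarith)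
  have hup' := hup.trans (ratMap_right_anti hq hM hm hb (by linarith))
  rw [le_ratMap_iff hq hM hm] at hup'
  rcases le_or_gt (p - q) (-r) with hρ | hρ
  · have hQ1 : 0 ≤ (q + 1) * 1 ^ 2 - (p + 1) * 1 - r := by linarith
    have h₁ := (quadratic_nonneg_mono hq hQ hL1.le le_rfl hQ1).1
    have hQm' : 0 ≤ (q + 1) * m ^ 2 - (p + 1) * m - r := by
      rcases le_total ((p - q) * m) (-r) with h | h
      · exact hQm h
      · have : 1 ≤ m := by
          refine le_of_mul_le_mul_left (a := p - q) ?_ ht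
          linarith
        exact (quadratic_nonneg_mono hq hQ hL1.le this hQ1).2
    have h₂ := (quadratic_nonneg_mono hq hQ hLm le_rfl hQm').1
    have h₃ : (q + 1) * (m + L) ≤ (q + 1) * (m + m) := by gcongr
    have h₄ : (q + 1) * (1 + L) < (q + 1) * (1 + 1) := by gcongr
    refine hmM.eq_or_lt.elim id fun hlt => ?_
    exfalso
    have h₅ : q * (M + m) + m ≤ p := by
      refine le_of_mul_le_mul_left (a := M - m) ?_ (sub_pos.2 hlt)
      linarith
    have h₆ : q * (m + m) < q * (M + m) := by gcongr
    have h₇ : (2 * q + 2) * (q * (m + m) + m) < (2 * q + 2) * p := by gcongr; linarith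
    have h₈ : (2 * q + 1) * (p + 1) < (2 * q + 1) * ((q + 1) * (m + m)) := by gcongr; linarith
    linarith
  have hQ1 : (q + 1) * 1 ^ 2 - (p + 1) * 1 - r < 0 := by linarith
  set K := -r / (p - q) with hK
  have hKt : (p - q) * K = -r := mul_div_cancel₀ _ ht.ne'
  have hK0 : 0 < K := div_pos (neg_pos.2 hr) ht
  have hK1 : K < 1 := (div_lt_one ht).2 hρ
  have hKm : K < m := by
    by_contra! hc
    have h₁ : (p - q) * m ≤ (p - q) * K := by gcongr
    have := (quadratic_nonneg_mono hq hQ hLm (hc.trans hK1.le) (hQm (h₁.trans hKt.le))).2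
    linarith
  have hKe : K < e := by
    by_contra! hc
    have := (quadratic_nonneg_mono hq hQ hLe (hc.trans hK1.le) hQe.ge).2
    linarith
  have hα : 0 < 1 - K := sub_pos.2 hK1
  have hc : 0 < K * (q + 1) := by positivity
  let φ : ℝ → ℝ → ℝ := fun x y => (1 - K) / x + (p - q) / (K * (q + 1) + q * x + y)
  have hmulφ : ∀ x y, 0 < x →
      x * φ x y = (1 - K) + (p - q) * x / (K * (q + 1) + q * x + y) := fun x y hx => by
    simp only [φ]
    rw [mul_add, mul_div_cancel₀ _ hx.ne']
    ring
  have hshift : ∀ x y, 0 < x → 0 < y → ratMap p q r (x + K) (y + K) - K = x * φ x y :=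
    fun x y hx hy => by
      rw [hmulφ x y hx]
      have h₁ : q * (x + K) + (y + K) ≠ 0 := by positivity
      have h₂ : K * (q + 1) + q * x + y ≠ 0 := by positivity
      have h₃ : r = -((p - q) * K) := by linarith
      unfold ratMap
      rw [h₃]
      field_simp
      ring
  have hposΛ : ∀ x ∈ Λ, 0 < x - K := fun x hx =>
    sub_pos.2 (hKm.trans_le (H.isLeast.2 hx))
  have hshift' : ∀ x ∈ Λ, ∀ y ∈ Λ, ratMap p q r x y - K = (x - K) * φ (x - K) (y - K) :=
    fun x hx y hy => by simpa using hshift _ _ (hposΛ x hx) (hposΛ y hy)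
  have H' : IsLimitRange (fun x y => x * φ x y) ((· - K) '' Λ) (m - K) (M - K) := by
    refine ⟨⟨⟨m, H.isLeast.1, rfl⟩, ?_⟩, ⟨⟨M, H.isGreatest.1, rfl⟩, ?_⟩, ?_, ?_⟩
    · rintro _ ⟨x, hx, rfl⟩
      exact sub_le_sub_right (H.isLeast.2 hx) K
    · rintro _ ⟨x, hx, rfl⟩
      exact sub_le_sub_right (H.isGreatest.2 hx) K
    · rintro _ ⟨x, hx, rfl⟩
      obtain ⟨a, ha, b, hb, d, hd, hxab, habd⟩ := H.backward x hx
      refine ⟨_, ⟨a, ha, rfl⟩, _, ⟨b, hb, rfl⟩, _, ⟨d, hd, rfl⟩, ?_, ?_⟩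
      · simp only
        rw [← hshift' a ha b hb, ← hxab]
      · simp only
        rw [← hshift' b hb d hd, ← habd]
    · rintro _ ⟨x, hx, rfl⟩
      obtain ⟨d, hd, hxd⟩ := H.forward x hx
      exact ⟨_, ⟨d, hd, rfl⟩, _, hxd, hshift' x hx d hd⟩
  have he : 0 < e - K := sub_pos.2 hKe
  have he0 := hK0.trans hKe
  have hfix : ratMap p q r e e = e := by
    have : q * e + e ≠ 0 := by positivity
    unfold ratMap
    rw [div_eq_iff this]
    linarith
  have hφe : φ (e - K) (e - K) = 1 := by
    have := hshift _ _ he he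
    rw [sub_add_cancel, hfix] at this
    exact (mul_eq_left₀ he.ne').1 this.symm
  have key : m - K = M - K := by
    refine H'.eq_of_product_kernel (sub_pos.2 hKm) he hφe ?_ ?_ ?_ ?_ ?_
    · intro x y hx hy
      simp only [φ]
      positivity
    · intro x x' y hx hxx hy
      have hx' := hx.trans hxx
      simp only [φ]
      gcongr
    · intro x y y' hx hy hyy
      have hy' := hy.trans_le hyy
      simp only [φ]
      gcongr
    · intro x x' y hx hxx hy
      have hx' := hx.trans_le hxx
      rw [hmulφ x y hx, hmulφ x' y hx', add_le_add_iff_left,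
        div_le_div_iff₀ (by positivity) (by positivity)]
      have : (p - q) * x * (K * (q + 1) + y) ≤ (p - q) * x' * (K * (q + 1) + y) := by gcongr
      linarith
    · intro x x' hx hxx
      have hx' := hx.trans hxx
      rw [hmulφ x x hx, hmulφ x' x' hx', add_lt_add_iff_left,
        div_lt_div_iff₀ (by positivity) (by positivity)]
      have : (p - q) * x * (K * (q + 1)) < (p - q) * x' * (K * (q + 1)) := by gcongr
      linarith
  linarith

end IsLimitRange

theorem exists_tendsto_of_mem_Icc_of_le_succ_or {u : ℕ → ℝ} {L b : ℝ} (hu : ∀ n, u n ∈ Icc L b)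
    (h : (∀ n, u n ≤ u (n + 1)) ∨ ∀ n, u (n + 1) ≤ u n) :
    ∃ l ∈ Icc L b, Tendsto u atTop (𝓝 l) := by
  have hmem : ∀ l, Tendsto u atTop (𝓝 l) → ∃ l ∈ Icc L b, Tendsto u atTop (𝓝 l) := fun l hl =>
    ⟨l, isClosed_Icc.mem_of_tendsto hl (Eventually.of_forall hu), hl⟩
  rcases h with h | h
  · exact hmem _ (tendsto_atTop_ciSup (monotone_nat_of_le_succ h)
      ⟨b, by rintro _ ⟨n, rfl⟩; exact (hu n).2⟩)
  · exact hmem _ (tendsto_atTop_ciInf (antitone_nat_of_succ_le h)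
      ⟨L, by rintro _ ⟨n, rfl⟩; exact (hu n).1⟩)

theorem exists_even_odd_limits {f : ℝ → ℝ → ℝ} {y : ℕ → ℝ} {L b : ℝ} (hy : ∀ n, y n ∈ Icc L b)
    (hrec : ∀ n, y (n + 2) = f (y (n + 1)) (y n)) {S : Set ℝ} (hS : ∀ᶠ n in atTop, y n ∈ S)
    (hf : ∀ x ∈ S, ∀ x' ∈ S, ∀ y ∈ S, ∀ y' ∈ S, x' ≤ x → y ≤ y' → f x y ≤ f x' y') :
    ∃ φ ∈ Icc L b, ∃ ψ ∈ Icc L b, Tendsto (fun n => y (2 * n)) atTop (𝓝 φ) ∧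
      Tendsto (fun n => y (2 * n + 1)) atTop (𝓝 ψ) := by
  obtain ⟨N, hN⟩ := eventually_atTop.1 hS
  have hup : ∀ n ≥ N, y n ≤ y (n + 2) → y (n + 3) ≤ y (n + 1) → y (n + 2) ≤ y (n + 4) :=
    fun n hn h h' => by
      rw [hrec n, hrec (n + 2)]
      exact hf _ (hN _ (by lia)) _ (hN _ (by lia)) _ (hN _ (by lia)) _ (hN _ (by lia)) h' h
  have hdown : ∀ n ≥ N, y (n + 2) ≤ y n → y (n + 1) ≤ y (n + 3) → y (n + 4) ≤ y (n + 2) :=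
    fun n hn h h' => by
      rw [hrec n, hrec (n + 2)]
      exact hf _ (hN _ (by lia)) _ (hN _ (by lia)) _ (hN _ (by lia)) _ (hN _ (by lia)) h' h
  have hmono : ∃ k, ∀ s, ((∀ n, y (2 * (n + k) + s) ≤ y (2 * (n + k) + s + 2)) ∨
      ∀ n, y (2 * (n + k) + s + 2) ≤ y (2 * (n + k) + s)) ∨ 2 ≤ s := by
    by_cases hopp : ∃ k ≥ N, (y k ≤ y (k + 2) ∧ y (k + 3) ≤ y (k + 1)) ∨
        (y (k + 2) ≤ y k ∧ y (k + 1) ≤ y (k + 3))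
    · obtain ⟨k, hkN, hk⟩ := hopp
      have hstep : ∀ n ≥ k, (y n ≤ y (n + 2) ∧ y (n + 3) ≤ y (n + 1)) ∨
          (y (n + 2) ≤ y n ∧ y (n + 1) ≤ y (n + 3)) := by
        intro n hn
        induction n, hn using Nat.le_induction with
        | base => exact hk
        | succ n hn ih =>
          rcases ih with ⟨h, h'⟩ | ⟨h, h'⟩
          · exact Or.inr ⟨h', hup n (hkN.trans hn) h h'⟩
          · exact Or.inl ⟨h', hdown n (hkN.trans hn) h h'⟩
      refine ⟨k, ?_⟩
      rcases hstep (2 * k) (by lia) with h | h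
      · have hall : ∀ n, y (2 * (n + k)) ≤ y (2 * (n + k) + 2) ∧
            y (2 * (n + k) + 3) ≤ y (2 * (n + k) + 1) := by
          intro n
          induction n with
          | zero => simpa using h
          | succ n ih =>
            have h₁ := hup (2 * (n + k)) (by lia) ih.1 ih.2
            have h₂ := hdown (2 * (n + k) + 1) (by lia) ih.2 h₁
            rw [show 2 * (n + 1 + k) = 2 * (n + k) + 2 by ring]
            exact ⟨h₁, h₂⟩
        rintro (_ | _ | s)
        · exact Or.inl (Or.inl fun n => (hall n).1)
        · exact Or.inl (Or.inr fun n => (hall n).2)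
        · exact Or.inr (by lia)
      · have hall : ∀ n, y (2 * (n + k) + 2) ≤ y (2 * (n + k)) ∧
            y (2 * (n + k) + 1) ≤ y (2 * (n + k) + 3) := by
          intro n
          induction n with
          | zero => simpa using h
          | succ n ih =>
            have h₁ := hdown (2 * (n + k)) (by lia) ih.1 ih.2
            have h₂ := hup (2 * (n + k) + 1) (by lia) ih.2 h₁
            rw [show 2 * (n + 1 + k) = 2 * (n + k) + 2 by ring]
            exact ⟨h₁, h₂⟩
        rintro (_ | _ | s)
        · exact Or.inl (Or.inr fun n => (hall n).1)
        · exact Or.inl (Or.inl fun n => (hall n).2)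
        · exact Or.inr (by lia)
    · push Not at hopp
      refine ⟨N, fun s => Or.inl ?_⟩
      rcases le_total (y N) (y (N + 2)) with h | h
      · have hall : ∀ n ≥ N, y n ≤ y (n + 2) := by
          intro n hn
          induction n, hn using Nat.le_induction with
          | base => exact h
          | succ n hn ih => exact ((hopp n hn).1 ih).le
        exact Or.inl fun n => hall _ (by lia)
      · have hall : ∀ n ≥ N, y (n + 2) ≤ y n := by
          intro n hn
          induction n, hn using Nat.le_induction with
          | base => exact h
          | succ n hn ih => exact ((hopp n hn).2 ih).le
        exact Or.inr fun n => hall _ (by lia)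
  obtain ⟨k, hk⟩ := hmono
  have hlim : ∀ s < 2, ∃ l ∈ Icc L b, Tendsto (fun n => y (2 * n + s)) atTop (𝓝 l) := by
    intro s hs
    obtain ⟨l, hl, hlim⟩ := exists_tendsto_of_mem_Icc_of_le_succ_or
      (u := fun n => y (2 * (n + k) + s)) (fun n => hy _) <|
        ((hk s).resolve_right (by lia)).imp
          (fun h n => by
            rw [show 2 * (n + 1 + k) + s = 2 * (n + k) + s + 2 by ring]
            exact h n)
          (fun h n => by
            rw [show 2 * (n + 1 + k) + s = 2 * (n + k) + s + 2 by ring]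
            exact h n)
    exact ⟨l, hl, (tendsto_add_atTop_iff_nat (f := fun n => y (2 * n + s)) k).1 hlim⟩
  obtain ⟨φ, hφ, hφl⟩ := hlim 0 (by norm_num)
  obtain ⟨ψ, hψ, hψl⟩ := hlim 1 (by norm_num)
  exact ⟨φ, hφ, ψ, hψ, hφl, hψl⟩

theorem tendsto_of_tendsto_even_odd_s2 {α : Type*} {l : Filter α} {y : ℕ → α}
    (he : Tendsto (fun n => y (2 * n)) atTop l)
    (ho : Tendsto (fun n => y (2 * n + 1)) atTop l) : Tendsto y atTop l := by
  intro s hs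
  obtain ⟨a, ha⟩ := eventually_atTop.1 (he hs)
  obtain ⟨b, hb⟩ := eventually_atTop.1 (ho hs)
  refine mem_map.2 (eventually_atTop.2 ⟨2 * a + 2 * b, fun n hn => ?_⟩)
  rcases n.even_or_odd' with ⟨k, rfl | rfl⟩
  · exact ha k (by lia)
  · exact hb k (by lia)

theorem quadratic_eq_of_isRoot {p q r L x x' : ℝ} (hq : 0 < q)
    (hL : (q + 1) * L ^ 2 - (p + 1) * L - r < 0) (hLx : L ≤ x) (hLx' : L ≤ x')
    (hx : (q + 1) * x ^ 2 - (p + 1) * x - r = 0)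
    (hx' : (q + 1) * x' ^ 2 - (p + 1) * x' - r = 0) : x = x' :=
  (le_total x x').elim (fun h => quadratic_eq_of_le hq hL hLx h hx.ge hx'.le)
    fun h => (quadratic_eq_of_le hq hL hLx' h hx'.ge hx.le).symm

theorem ratMap_self_eq_iff {p q r x : ℝ} (hq : 0 < q) (hx : 0 < x) :
    x = ratMap p q r x x ↔ (q + 1) * x ^ 2 - (p + 1) * x - r = 0 := by
  have : q * x + x ≠ 0 := by positivity
  rw [ratMap, eq_div_iff this]
  constructor <;> intro h <;> linarith

theorem equilibrium_spec {p q r L : ℝ} (hq : 0 < q)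
    (hL : (q + 1) * L ^ 2 - (p + 1) * L - r < 0) {e : ℝ}
    (he : e = (p + 1 + √((p + 1) ^ 2 + 4 * r * (q + 1))) / (2 * (q + 1))) :
    (q + 1) * e ^ 2 - (p + 1) * e - r = 0 ∧ L ≤ e := by
  have hlt : (2 * (q + 1) * L - (p + 1)) ^ 2 < (p + 1) ^ 2 + 4 * r * (q + 1) := by
    have := mul_neg_of_pos_of_neg (a := 4 * (q + 1)) (by positivity) hL
    linarith
  have hs := Real.sq_sqrt ((sq_nonneg _).trans hlt.le)
  have hLs := (Real.abs_le_sqrt hlt.le)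
  set s := √((p + 1) ^ 2 + 4 * r * (q + 1))
  have he' : 2 * (q + 1) * e = p + 1 + s := by
    rw [he]
    field_simp
  refine ⟨?_, ?_⟩
  · have h₁ : (2 * (q + 1) * e - (p + 1)) ^ 2 = s ^ 2 := by rw [he']; ring
    refine (mul_eq_zero_iff_left (a := 4 * (q + 1)) (by positivity)).1 ?_
    linarith
  · refine le_of_mul_le_mul_left (a := 2 * (q + 1)) ?_ (by positivity)
    linarith [(le_abs_self _).trans hLs]

section Solutions

variable {p q r L : ℝ}

theorem le_ratMap_of_le (hq : 0 < q) (hL : 0 < L) (hL1 : L < 1) (hp : q * L < p)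
    (hQ : (q + 1) * L ^ 2 - (p + 1) * L - r < 0) {x y : ℝ} (hx : L ≤ x) (hy : L ≤ y) :
    L ≤ ratMap p q r x y := by
  rw [le_ratMap_iff hq (hL.trans_le hx) (hL.trans_le hy)]
  have h₁ : 0 ≤ (p - q * L) * (x - L) := mul_nonneg (by linarith) (by linarith)
  have h₂ : 0 ≤ (1 - L) * (y - L) := mul_nonneg (by linarith) (by linarith)
  linarith

theorem ratMap_le_of_le (hq : 0 < q) (hL : 0 < L) (hp : 0 < p) {x y : ℝ} (hx : L ≤ x)
    (hy : L ≤ y) : ratMap p q r x y ≤ |r| / ((q + 1) * L) + p / q + 1 := by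
  have hx0 := hL.trans_le hx
  have hy0 := hL.trans_le hy
  rw [ratMap_le_iff hq hx0 hy0]
  have h₁ : r ≤ |r| / ((q + 1) * L) * (q * x + y) := by
    calc r ≤ |r| := le_abs_self r
      _ = |r| / ((q + 1) * L) * (q * L + L) := by field_simp
      _ ≤ |r| / ((q + 1) * L) * (q * x + y) := by gcongr
  have h₂ : p / q * (q * x) = p * x := by field_simp
  have h₃ : 0 ≤ p / q * y := by positivity
  have h₄ : 0 ≤ q * x := by positivity
  linarith

theorem exists_forall_mem_Icc_of_rec (hq : 0 < q) (hL : 0 < L) (hL1 : L < 1) (hp : q * L < p)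
    (hQ : (q + 1) * L ^ 2 - (p + 1) * L - r < 0) {y : ℕ → ℝ} (hy0 : L ≤ y 0) (hy1 : L ≤ y 1)
    (hrec : ∀ n, y (n + 2) = ratMap p q r (y (n + 1)) (y n)) : ∃ b, ∀ n, y n ∈ Icc L b := by
  have hp0 : 0 < p := (mul_pos hq hL).trans hp
  have hlow : ∀ n, L ≤ y n ∧ L ≤ y (n + 1) := by
    intro n
    induction n with
    | zero => exact ⟨hy0, hy1⟩
    | succ n ih => exact ⟨ih.2, (hrec n).symm ▸ le_ratMap_of_le hq hL hL1 hp hQ ih.2 ih.1⟩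
  refine ⟨max (max (y 0) (y 1)) (|r| / ((q + 1) * L) + p / q + 1), ?_⟩
  rintro (_ | _ | n)
  · exact ⟨hy0, (le_max_left _ _).trans (le_max_left _ _)⟩
  · exact ⟨hy1, (le_max_right _ _).trans (le_max_left _ _)⟩
  · refine ⟨(hlow _).1, le_max_of_le_right ?_⟩
    rw [hrec n]
    exact ratMap_le_of_le hq hL hp0 (hlow n).2 (hlow n).1

theorem continuousAt_ratMap (hq : 0 < q) {x y : ℝ} (hx : 0 < x) (hy : 0 < y) :
    ContinuousAt (fun z : ℝ × ℝ => ratMap p q r z.1 z.2) (x, y) := by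
  have : q * x + y ≠ 0 := by positivity
  unfold ratMap
  exact ContinuousAt.div (by fun_prop) (by fun_prop) this

theorem tendsto_equilibrium_of_lt_one {y : ℕ → ℝ} {b e : ℝ} (hq : 0 < q) (hq1 : q < 1)
    (hL : 0 < L) (hpq : q < p) (hr : 0 ≤ r) (he : 0 < e) (hqe : q * e < p)
    (hQe : (q + 1) * e ^ 2 - (p + 1) * e - r = 0) (hy : ∀ n, y n ∈ Icc L b)
    (hrec : ∀ n, y (n + 2) = ratMap p q r (y (n + 1)) (y n)) : Tendsto y atTop (𝓝 e) := by
  have hpos : ∀ n, 0 < y n := fun n => hL.trans_le (hy n).1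
  have hgt : ∀ n, 1 < y (n + 2) := fun n => by
    have h₀ := hpos n
    have h₁ := hpos (n + 1)
    rw [hrec n, ratMap, one_lt_div (by positivity)]
    have : 0 < (p - q) * y (n + 1) := mul_pos (sub_pos.2 hpq) h₁
    linarith
  have hdiff : 1 - 1 / e - (p / e - q) = r / e ^ 2 := by
    field_simp
    linarith
  have hlim : Tendsto (fun n => y (n + 2) / e) atTop (𝓝 1) := by
    refine tendsto_one_of_lyapunov (g := p / e - q) (h := 1 - 1 / e) (q := q) (b := b / e)
      ?_ ?_ ?_ hq hq1.le ?_ ?_ ?_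
    · rw [sub_pos, lt_div_iff₀ he]
      exact hqe
    · rw [← sub_nonneg, hdiff]
      positivity
    · have : 0 < 1 / e := by positivity
      linarith
    · intro n
      have := hgt n
      rw [sub_sub_cancel]
      gcongr
    · intro n
      have := (hy (n + 2)).2
      gcongr
    · intro n
      have h₀ := hpos (n + 2)
      have h₁ := hpos (n + 3)
      rw [hdiff, hrec (n + 2), ratMap]
      field_simp
      ring
  have := (hlim.mul_const e).congr fun n => div_mul_cancel₀ (y (n + 2)) he.ne'
  rw [one_mul] at this
  exact (tendsto_add_atTop_iff_nat 2).1 this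

theorem tendsto_equilibrium_or_twoCycle (hq : 0 < q) (hL : 0 < L) (hL1 : L < 1) (hp : q * L < p)
    (hQ : (q + 1) * L ^ 2 - (p + 1) * L - r < 0) {y : ℕ → ℝ} (hy0 : L ≤ y 0) (hy1 : L ≤ y 1)
    (hrec : ∀ n, y (n + 2) = ratMap p q r (y (n + 1)) (y n)) {e : ℝ} (hLe : L ≤ e)
    (hQe : (q + 1) * e ^ 2 - (p + 1) * e - r = 0) :
    Tendsto y atTop (𝓝 e) ∨ ∃ φ ψ : ℝ, φ ≠ ψ ∧ L ≤ φ ∧ L ≤ ψ ∧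
      φ = ratMap p q r ψ φ ∧ ψ = ratMap p q r φ ψ ∧
      Tendsto (fun n => y (2 * n)) atTop (𝓝 φ) ∧
      Tendsto (fun n => y (2 * n + 1)) atTop (𝓝 ψ) := by
  have hp0 : 0 < p := (mul_pos hq hL).trans hp
  have he := hL.trans_le hLe
  obtain ⟨b, hy⟩ := exists_forall_mem_Icc_of_rec hq hL hL1 hp hQ hy0 hy1 hrec
  have hcont : ∀ x ∈ Icc L b, ∀ y ∈ Icc L b,
      ContinuousAt (fun z : ℝ × ℝ => ratMap p q r z.1 z.2) (x, y) := fun x hx y hy =>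
    continuousAt_ratMap hq (hL.trans_le hx.1) (hL.trans_le hy.1)
  obtain ⟨m, M, hLm, hmM, H, hev, htend⟩ := exists_isLimitRange hy hcont hrec
  have hm := hL.trans_le hLm
  have hroot : ∀ x, L ≤ x → x = ratMap p q r x x → x = e := fun x hx hfx =>
    quadratic_eq_of_isRoot hq hQ hx hLe ((ratMap_self_eq_iff hq (hL.trans_le hx)).1 hfx) hQe
  have hconv : m = M → Tendsto y atTop (𝓝 e) := fun h => by
    obtain ⟨a, c, ha, haM, hc, hcM, hac⟩ := H.exists_eq_lower
    rw [← h] at haM hcM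
    rw [le_antisymm haM ha, le_antisymm hcM hc] at hac
    exact hroot m hLm hac ▸ htend h
  have hcycle : (p < q ∧ r < (q - p) * m ∧ 0 < q * r + (q - p) * m) →
      Tendsto y atTop (𝓝 e) ∨ ∃ φ ψ : ℝ, φ ≠ ψ ∧ L ≤ φ ∧ L ≤ ψ ∧
        φ = ratMap p q r ψ φ ∧ ψ = ratMap p q r φ ψ ∧
        Tendsto (fun n => y (2 * n)) atTop (𝓝 φ) ∧
        Tendsto (fun n => y (2 * n + 1)) atTop (𝓝 ψ) := by
    rintro ⟨hpq, h₁, h₂⟩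
    have ht : 0 < q - p := sub_pos.2 hpq
    have hS : ∀ᶠ n in atTop,
        y n ∈ {x | 0 < x ∧ r ≤ (q - p) * x ∧ 0 ≤ q * r + (q - p) * x} := by
      have hK₁ : r / (q - p) < m := by rwa [div_lt_iff₀' ht]
      have hK₂ : -(q * r) / (q - p) < m := by
        rw [div_lt_iff₀' ht]
        linarith
      filter_upwards [hev _ hK₁, hev _ hK₂] with n hn₁ hn₂
      rw [div_lt_iff₀' ht] at hn₁ hn₂
      exact ⟨hL.trans_le (hy n).1, hn₁.le, by linarith⟩
    obtain ⟨φ, hφ, ψ, hψ, hφl, hψl⟩ := exists_even_odd_limits hy hrec hS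
      fun x hx x' hx' z hz z' hz' hxx hzz =>
        (ratMap_right_mono hq hx.1 hz.1 hzz hx.2.1).trans
          (ratMap_left_anti hq hx'.1 hz'.1 hxx hz'.2.2)
    have hφf : φ = ratMap p q r ψ φ := by
      refine tendsto_nhds_unique ((tendsto_add_atTop_iff_nat 1).2 hφl) ?_
      exact ((hcont ψ hψ φ hφ).tendsto.comp (hψl.prodMk_nhds hφl)).congr
        fun n => (hrec (2 * n)).symm
    have hψf : ψ = ratMap p q r φ ψ := by
      refine tendsto_nhds_unique ((tendsto_add_atTop_iff_nat 1).2 hψl) ?_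
      exact ((hcont φ hφ ψ hψ).tendsto.comp
        (((tendsto_add_atTop_iff_nat 1).2 hφl).prodMk_nhds hψl)).congr
        fun n => (hrec (2 * n + 1)).symm
    by_cases hne : φ = ψ
    · subst hne
      exact Or.inl (hroot φ hφ.1 hφf ▸ tendsto_of_tendsto_even_odd_s2 hφl hψl)
    · exact Or.inr ⟨φ, ψ, hne, hφ.1, hψ.1, hφf, hψf, hφl, hψl⟩
  rcases le_or_gt p q with hpq | hpq
  · rcases lt_or_ge 0 r with hr | hr
    · exact (H.eq_or_of_pos_of_le hq hp0 hm hpq hr).elim (fun h => Or.inl (hconv h)) hcycle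
    · exact (H.eq_or_of_nonpos_of_le hq hp0 hL hQ hLm hpq hr).elim
        (fun h => Or.inl (hconv h)) hcycle
  · left
    rcases le_or_gt 0 r with hr | hr
    · rcases H.eq_or_of_nonneg_of_lt hq hm hpq hr he hQe with h | ⟨hq1, hqe⟩
      · exact hconv h
      · exact tendsto_equilibrium_of_lt_one hq hq1 hL hpq hr he hqe hQe hy hrec
    · exact hconv (H.eq_of_neg_of_lt hq hL hL1 hQ hLm hpq hr hLe hQe)

end Solutions

/-- Theorem (Eq. (3-2-L)): with `p, q, r, L` defined from positive parameters
`α, β, γ, A, B, C`, every solution with initial conditions in `[L, ∞)`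
converges to the equilibrium or to a (prime period-two) pair `(φ, ψ)`.
Here `y 0` plays the role of `y_{-1}` and `y 1` of `y_0`. -/
theorem stmt_2 (α β γ A B C : ℝ)
    (hα : 0 < α) (hβ : 0 < β) (hγ : 0 < γ) (hA : 0 < A) (hB : 0 < B) (hC : 0 < C)
    (p q r L : ℝ)
    (hp : p = (A * B + (B + C) * β) / (A * C + (B + C) * γ))
    (hq : q = B / C)
    (hr : r = C * (B + C) * (B * α + C * α - A * β - A * γ) / (γ * (B + C) + A * C) ^ 2)
    (hL : L = A * C / (A * C + (B + C) * γ))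
    (y : ℕ → ℝ) (hy0 : L ≤ y 0) (hy1 : L ≤ y 1)
    (hrec : ∀ n : ℕ, y (n + 2) = (r + p * y (n + 1) + y n) / (q * y (n + 1) + y n)) :
    Tendsto y atTop
      (nhds ((p + 1 + Real.sqrt ((p + 1) ^ 2 + 4 * r * (q + 1))) / (2 * (q + 1)))) ∨
      ∃ φ ψ : ℝ, φ ≠ ψ ∧ L ≤ φ ∧ L ≤ ψ ∧
        φ = (r + p * ψ + φ) / (q * ψ + φ) ∧
        ψ = (r + p * φ + ψ) / (q * φ + ψ) ∧
        ((Tendsto (fun n => y (2 * n)) atTop (nhds φ) ∧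
          Tendsto (fun n => y (2 * n + 1)) atTop (nhds ψ)) ∨
         (Tendsto (fun n => y (2 * n)) atTop (nhds ψ) ∧
          Tendsto (fun n => y (2 * n + 1)) atTop (nhds φ))) := by
  have hD : 0 < A * C + (B + C) * γ := by positivity
  have hq0 : 0 < q := hq ▸ div_pos hB hC
  have hL0 : 0 < L := hL ▸ div_pos (mul_pos hA hC) hD
  have hL1 : L < 1 := by
    rw [hL, div_lt_one hD]
    have : 0 < (B + C) * γ := by positivity
    linarith
  have hqL : q * L < p := by
    have : q * L = A * B / (A * C + (B + C) * γ) := by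
      rw [hq, hL]
      field_simp
    rw [this, hp]
    gcongr
    have : 0 < (B + C) * β := by positivity
    linarith
  have hQ : (q + 1) * L ^ 2 - (p + 1) * L - r < 0 := by
    have h : (q + 1) * L ^ 2 - (p + 1) * L - r =
        -(C * (B + C) ^ 2 * α / (A * C + (B + C) * γ) ^ 2) := by
      rw [hq, hL, hp, hr, show γ * (B + C) + A * C = A * C + (B + C) * γ by ring]
      field_simp
      ring
    rw [h, neg_lt_zero]
    positivity
  obtain ⟨hQe, hLe⟩ := equilibrium_spec hq0 hQ rfl
  refine (tendsto_equilibrium_or_twoCycle hq0 hL0 hL1 hqL hQ hy0 hy1 hrec hLe hQe).imp id ?_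
  rintro ⟨φ, ψ, hne, hφ, hψ, hφf, hψf, hφl, hψl⟩
  exact ⟨φ, ψ, hne, hφ, hψ, hφf, hψf, Or.inl ⟨hφl, hψl⟩⟩
end
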